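/- arXiv:2201.11100 — 2 statements merged into one kernel-verified Lean document; each statement's English description precedes it below -/
import Mathlib

section
/- Let Ω ⊂ ℝ² be a bounded open set with smooth boundary, let x₀ ∈ ℝ² and ν ∈ ℝ, and let R > 0 be such that the disk B(x₀,R) has the same Lebesgue measure as Ω (i.e. πR² = |Ω|). Then λ₁(Ω, A_{x₀,ν}) ≤ λ₁(B(x₀,R), A_{x₀,ν}). Moreover, if ν ∉ ℤ and equality holds, then Ω = B(x₀,R). -/
open MeasureTheory

noncomputable def AB (x₀ : EuclideanSpace ℝ (Fin 2)) (ν : ℝ)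
    (x : EuclideanSpace ℝ (Fin 2)) : Fin 2 → ℝ := fun i =>
  if i = 0 then -ν * (x 1 - x₀ 1) / ‖x - x₀‖ ^ 2 else ν * (x 0 - x₀ 0) / ‖x - x₀‖ ^ 2

noncomputable def magGradSq (A : EuclideanSpace ℝ (Fin 2) → Fin 2 → ℝ)
    (u : EuclideanSpace ℝ (Fin 2) → ℂ) (x : EuclideanSpace ℝ (Fin 2)) : ℝ :=
  ∑ i : Fin 2, ‖fderiv ℝ u x (EuclideanSpace.single i 1) - Complex.I * u x * (A x i)‖ ^ 2

def VanishesNear (x₀ : EuclideanSpace ℝ (Fin 2)) (u : EuclideanSpace ℝ (Fin 2) → ℂ) : Prop :=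
  ∃ ε > 0, ∀ x ∈ Metric.ball x₀ ε, u x = 0

noncomputable def lambda1 (x₀ : EuclideanSpace ℝ (Fin 2)) (ν : ℝ)
    (D : Set (EuclideanSpace ℝ (Fin 2))) : ℝ :=
  sInf {q | ∃ u : EuclideanSpace ℝ (Fin 2) → ℂ, ContDiff ℝ (⊤ : ℕ∞) u ∧ VanishesNear x₀ u ∧
    0 < ∫ x in D, ‖u x‖ ^ 2 ∧
    q = (∫ x in D, magGradSq (AB x₀ ν) u x) / ∫ x in D, ‖u x‖ ^ 2}

noncomputable def sigma1 (x₀ : EuclideanSpace ℝ (Fin 2)) (ν : ℝ)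
    (D : Set (EuclideanSpace ℝ (Fin 2))) : ℝ :=
  sInf {q | ∃ u : EuclideanSpace ℝ (Fin 2) → ℂ, ContDiff ℝ (⊤ : ℕ∞) u ∧ VanishesNear x₀ u ∧
    0 < ∫ x in frontier D, ‖u x‖ ^ 2 ∂(μH[1]) ∧
    q = (∫ x in D, magGradSq (AB x₀ ν) u x) / ∫ x in frontier D, ‖u x‖ ^ 2 ∂(μH[1])}

def HasSmoothBoundary {E : Type*} [NormedAddCommGroup E] [NormedSpace ℝ E] (Ω : Set E) : Prop :=
  ∀ x ∈ frontier Ω, ∃ (f : E → ℝ) (ε : ℝ), 0 < ε ∧ ContDiff ℝ (⊤ : ℕ∞) f ∧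
    fderiv ℝ f x ≠ 0 ∧ ∀ y ∈ Metric.ball x ε, (y ∈ Ω ↔ f y < 0)

noncomputable def distInt (ν : ℝ) : ℝ := ⨅ k : ℤ, |ν - (k : ℝ)|

/-- Taylor coefficients (up to sign) of the confluent hypergeometric limit function `₀F₁(; b; ·)`. -/
noncomputable def hypCoeff (b : ℝ) (m : ℕ) : ℝ :=
  1 / ((m.factorial : ℝ) * ∏ i ∈ Finset.range m, (b + i))

/-- The confluent hypergeometric limit function `t ↦ ₀F₁(; b; -t)`. -/
noncomputable def hypF (b t : ℝ) : ℝ := ∑' m : ℕ, (-t) ^ m * hypCoeff b m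

lemma hypCoeff_zero (b : ℝ) : hypCoeff b 0 = 1 := by simp [hypCoeff]

lemma one_le_prod_add {b : ℝ} (hb : 1 ≤ b) (m : ℕ) :
    1 ≤ ∏ i ∈ Finset.range m, (b + i) := by
  induction m with
  | zero => simp
  | succ m ih =>
    rw [Finset.prod_range_succ]
    have : (0 : ℝ) ≤ m := m.cast_nonneg
    nlinarith

lemma hypCoeff_nonneg {b : ℝ} (hb : 1 ≤ b) (m : ℕ) : 0 ≤ hypCoeff b m := by
  have := one_le_prod_add hb m
  unfold hypCoeff
  positivity

lemma hypCoeff_le {b : ℝ} (hb : 1 ≤ b) (m : ℕ) : hypCoeff b m ≤ 1 / (m.factorial : ℝ) := by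
  have := one_le_prod_add hb m
  have h2 : (0 : ℝ) < m.factorial := by positivity
  unfold hypCoeff
  apply one_div_le_one_div_of_le h2
  nlinarith

lemma hypCoeff_succ {b : ℝ} (hb : 1 ≤ b) (m : ℕ) :
    (m + 1 : ℝ) * hypCoeff b (m + 1) = hypCoeff (b + 1) m / b := by
  have h1 := one_le_prod_add (b := b + 1) (by linarith) m
  have h2 : (0 : ℝ) < m.factorial := by positivity
  have h3 : ∏ i ∈ Finset.range (m + 1), (b + (i : ℕ))
      = (∏ i ∈ Finset.range m, (b + 1 + (i : ℕ))) * b := by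
    rw [Finset.prod_range_succ']
    congr 1
    · refine Finset.prod_congr rfl fun i _ => ?_
      push_cast; ring
    · simp
  unfold hypCoeff
  rw [h3, Nat.factorial_succ]
  push_cast
  have : (∏ i ∈ Finset.range m, (b + 1 + (i : ℕ))) ≠ 0 := by positivity
  field_simp

lemma hypCoeff_succ' {b : ℝ} (hb : 1 ≤ b) (m : ℕ) :
    hypCoeff b (m + 1) * ((m + 1) * (b + m)) = hypCoeff b m := by
  have h1 := one_le_prod_add hb m
  have h2 : (0 : ℝ) < m.factorial := by positivity
  have h3 : (0 : ℝ) ≤ m := m.cast_nonneg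
  unfold hypCoeff
  rw [Finset.prod_range_succ, Nat.factorial_succ]
  push_cast
  have : (∏ i ∈ Finset.range m, (b + (i : ℕ))) ≠ 0 := by positivity
  field_simp

lemma summable_hypF {b : ℝ} (hb : 1 ≤ b) (t : ℝ) :
    Summable fun m : ℕ => (-t) ^ m * hypCoeff b m := by
  refine Summable.of_norm_bounded (Real.summable_pow_div_factorial |t|) fun m => ?_
  rw [norm_mul, norm_pow, Real.norm_eq_abs, abs_neg, Real.norm_eq_abs,
    abs_of_nonneg (hypCoeff_nonneg hb m), div_eq_mul_one_div]
  gcongr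
  exact hypCoeff_le hb m

lemma hypF_zero (b : ℝ) : hypF b 0 = 1 := by
  unfold hypF
  rw [tsum_eq_single 0]
  · simp [hypCoeff_zero]
  · intro m hm
    simp [hm]

lemma hasDerivAt_hypF {b : ℝ} (hb : 1 ≤ b) (t : ℝ) :
    HasDerivAt (hypF b) (-(1 / b) * hypF (b + 1) t) t := by
  have hb1 : 1 ≤ b + 1 := by linarith
  set f' : ℕ → ℝ → ℝ := fun m s => m * (-s) ^ (m - 1) * (-1) * hypCoeff b m with hf'
  have hder : ∀ (m : ℕ) (s : ℝ), HasDerivAt (fun s => (-s) ^ m * hypCoeff b m) (f' m s) s := by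
    intro m s
    exact ((hasDerivAt_neg s).fun_pow m).mul_const _
  have hsucc : ∀ (m : ℕ) (s : ℝ), f' (m + 1) s = -(1 / b) * ((-s) ^ m * hypCoeff (b + 1) m) := by
    intro m s
    have := hypCoeff_succ hb m
    simp only [hf', Nat.add_sub_cancel]
    push_cast
    calc _ = -(-s) ^ m * ((m + 1 : ℝ) * hypCoeff b (m + 1)) := by ring
      _ = _ := by rw [this]; ring
  set M := |t| + 1
  have hM : 0 < M := by positivity
  let u : ℕ → ℝ := fun m => m.casesOn 0 fun m => M ^ m / m.factorial
  have hu : Summable u := (summable_nat_add_iff 1).1 (Real.summable_pow_div_factorial M)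
  have key := hasDerivAt_tsum_of_isPreconnected (g := fun m s => (-s) ^ m * hypCoeff b m) (g' := f')
    hu (t := Metric.ball 0 M) Metric.isOpen_ball (convex_ball 0 M).isPreconnected
    (fun m s _ => hder m s) (y₀ := t) (y := t)
    (fun m s hs => by
      rw [mem_ball_zero_iff, Real.norm_eq_abs] at hs
      cases m with
      | zero => simp [hf', u]
      | succ m =>
        rw [hsucc, norm_mul, norm_mul, norm_pow, norm_neg, norm_neg, Real.norm_eq_abs s,
          Real.norm_eq_abs (hypCoeff _ _), abs_of_nonneg (hypCoeff_nonneg hb1 m)]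
        have h1 : ‖1 / b‖ ≤ 1 := by
          rw [Real.norm_eq_abs, abs_of_nonneg (by positivity)]
          exact (div_le_one (by linarith)).2 hb
        have h2 := hypCoeff_le hb1 m
        have h3 := hypCoeff_nonneg hb1 m
        calc ‖1 / b‖ * (|s| ^ m * hypCoeff (b + 1) m)
            ≤ 1 * (M ^ m * (1 / m.factorial)) := by gcongr
          _ = u (m + 1) := by simp [u]; ring)
    (by simp [M]) (summable_hypF hb t) (by simp [M])
  have hs : Summable fun m => f' m t := by
    rw [← summable_nat_add_iff 1]
    simp_rw [hsucc]
    exact (summable_hypF hb1 t).mul_left _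
  rw [hs.tsum_eq_zero_add] at key
  simp_rw [hsucc, tsum_mul_left] at key
  have h0 : f' 0 t = 0 := by simp [hf']
  rw [h0, zero_add] at key
  exact key

lemma contDiff_hypF {b : ℝ} (hb : 1 ≤ b) : ContDiff ℝ (⊤ : ℕ∞) (hypF b) := by
  rw [contDiff_infty]
  intro n
  induction n generalizing b with
  | zero =>
    exact contDiff_zero.2 (continuous_iff_continuousAt.2 fun t =>
      (hasDerivAt_hypF hb t).continuousAt)
  | succ n ih =>
    push_cast
    rw [contDiff_succ_iff_deriv]
    refine ⟨fun t => (hasDerivAt_hypF hb t).differentiableAt, by simp, ?_⟩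
    have : deriv (hypF b) = fun t => -(1 / b) * hypF (b + 1) t :=
      funext fun t => (hasDerivAt_hypF hb t).deriv
    rw [this]
    exact contDiff_const.mul (ih (by linarith))

lemma hypF_contiguous {b : ℝ} (hb : 1 ≤ b) (t : ℝ) :
    hypF b t = hypF (b + 1) t - t / (b * (b + 1)) * hypF (b + 2) t := by
  have h1 : 1 ≤ b + 1 := by linarith
  have h2 : 1 ≤ b + 2 := by linarith
  unfold hypF
  rw [(summable_hypF hb t).tsum_eq_zero_add, (summable_hypF h1 t).tsum_eq_zero_add,
    ← tsum_mul_left, add_sub_assoc, ← Summable.tsum_sub]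
  · simp only [pow_zero, hypCoeff_zero]
    congr 1
    refine tsum_congr fun m => ?_
    have e1 := hypCoeff_succ hb m
    have e2 := hypCoeff_succ' h1 m
    have e3 := hypCoeff_succ h1 m
    have hm : (0 : ℝ) ≤ m := m.cast_nonneg
    rw [show b + 1 + 1 = b + 2 by ring] at e3
    have e4 : hypCoeff (b + 2) m = (m + 1) * hypCoeff (b + 1) (m + 1) * (b + 1) := by
      rw [e3]; field_simp
    have e5 : hypCoeff b (m + 1) = hypCoeff (b + 1) (m + 1) * (b + 1 + m) / b := by
      have : (m + 1 : ℝ) ≠ 0 := by positivity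
      rw [← e2] at e1
      field_simp at e1 ⊢
      linarith
    rw [e4, e5, pow_succ]
    field_simp
    ring
  · exact (summable_nat_add_iff 1).2 (summable_hypF h1 t)
  · exact (summable_hypF h2 t).mul_left _

lemma hypF_bounds {b t : ℝ} (hb : 1 ≤ b) (ht0 : 0 ≤ t) (ht1 : t ≤ 1) :
    1 - t / b ≤ hypF b t ∧ hypF b t ≤ 1 := by
  have hanti : Antitone fun m => t ^ m * hypCoeff b m := by
    refine antitone_nat_of_succ_le fun m => ?_
    have h0 := hypCoeff_nonneg hb (m + 1)
    have h1 := hypCoeff_nonneg hb m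
    have h2 : hypCoeff b (m + 1) ≤ hypCoeff b m := by
      rw [← hypCoeff_succ' hb m]
      have hm : (0 : ℝ) ≤ m := m.cast_nonneg
      nlinarith [mul_nonneg h0 hm, mul_nonneg h0 (mul_nonneg hm hm),
        mul_nonneg h0 (mul_nonneg hm (sub_nonneg.2 hb)), mul_nonneg h0 (sub_nonneg.2 hb)]
    exact mul_le_mul (pow_le_pow_of_le_one ht0 ht1 m.le_succ) h2 h0 (by positivity)
  have hs : Filter.Tendsto (fun n => ∑ i ∈ Finset.range n, (-1) ^ i * (t ^ i * hypCoeff b i))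
      Filter.atTop (nhds (hypF b t)) := by
    have := (summable_hypF hb t).hasSum.tendsto_sum_nat
    refine this.congr fun n => Finset.sum_congr rfl fun i _ => ?_
    rw [neg_pow, mul_assoc]
  have l := hanti.alternating_series_le_tendsto hs 1
  have r := hanti.tendsto_le_alternating_series hs 0
  have e := hypCoeff_succ' hb 0
  simp [Finset.sum_range_succ, hypCoeff_zero] at l r e
  have : hypCoeff b 1 = 1 / b := by field_simp; exact e
  rw [this, mul_one_div] at l
  exact ⟨by linarith, r⟩

/-- `r g'(r) / r ^ μ` for the radial profile `g(r) = r ^ μ * hypF (μ + 1) (τ (r / R) ^ 2)`, as a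
function of `t = τ (r / R) ^ 2`. -/
noncomputable def hypH (μ t : ℝ) : ℝ :=
  μ * hypF (μ + 1) t + 2 * t * (-(1 / (μ + 1)) * hypF (μ + 2) t)

lemma hasDerivAt_hypH {μ : ℝ} (hμ : 0 < μ) (t : ℝ) :
    HasDerivAt (hypH μ) (μ / (μ + 1) * hypF (μ + 2) t - 2 * hypF (μ + 1) t) t := by
  have d0 := hasDerivAt_hypF (b := μ + 1) (by linarith) t
  have d1 := hasDerivAt_hypF (b := μ + 2) (by linarith) t
  have c := hypF_contiguous (b := μ + 1) (by linarith) t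
  rw [show μ + 1 + 1 = μ + 2 by ring] at d0 c
  rw [show μ + 2 + 1 = μ + 3 by ring] at d1
  rw [show μ + 1 + 2 = μ + 3 by ring] at c
  have := (d0.const_mul μ).add
    (((hasDerivAt_id t).const_mul 2).mul (d1.const_mul (-(1 / (μ + 1)))))
  refine this.congr_deriv ?_
  rw [c]
  simp only [id]
  field_simp
  ring

lemma hypF_pos {b t : ℝ} (hb : 1 < b) (ht0 : 0 ≤ t) (ht1 : t ≤ 1) : 0 < hypF b t := by
  have h1 := (hypF_bounds hb.le ht0 ht1).1
  have : t / b < 1 := (div_lt_one (by linarith)).2 (by linarith)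
  linarith

lemma exists_hypH_zero {μ : ℝ} (hμ : 0 < μ) (hμ2 : μ ≤ 1 / 2) :
    ∃ τ, 0 < τ ∧ τ ≤ μ ∧ hypH μ τ = 0 ∧ ∀ t, 0 ≤ t → t < τ → 0 < hypH μ t := by
  have hcont : Continuous (hypH μ) :=
    continuous_iff_continuousAt.2 fun t => (hasDerivAt_hypH hμ t).continuousAt
  have h0 : hypH μ 0 = μ := by simp [hypH, hypF_zero]
  have h1 : hypH μ μ ≤ 0 := by
    have a := (hypF_bounds (b := μ + 1) (t := μ) (by linarith) hμ.le (by linarith)).2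
    have b := (hypF_bounds (b := μ + 2) (t := μ) (by linarith) hμ.le (by linarith)).1
    have c : 1 - μ / (μ + 2) = 2 / (μ + 2) := by field_simp; ring
    rw [c] at b
    have e : (1 : ℝ) / 2 ≤ 1 / (μ + 1) * (2 / (μ + 2)) := by
      rw [div_mul_div_comm, div_le_div_iff₀ (by positivity) (by positivity)]
      nlinarith
    have f : 1 / (μ + 1) * (2 / (μ + 2)) ≤ 1 / (μ + 1) * hypF (μ + 2) μ := by gcongr
    unfold hypH
    nlinarith
  have hanti : StrictAntiOn (hypH μ) (Set.Icc 0 1) := by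
    refine strictAntiOn_of_deriv_neg (convex_Icc 0 1) hcont.continuousOn fun t ht => ?_
    rw [interior_Icc] at ht
    rw [(hasDerivAt_hypH hμ t).deriv]
    have a := (hypF_bounds (b := μ + 1) (t := t) (by linarith) ht.1.le ht.2.le).1
    have b := (hypF_bounds (b := μ + 2) (t := t) (by linarith) ht.1.le ht.2.le).2
    have c : t / (μ + 1) ≤ 1 / (μ + 1) := by gcongr; exact ht.2.le
    have d : 1 - 1 / (μ + 1) = μ / (μ + 1) := by field_simp; ring
    have e : 0 < μ / (μ + 1) := by positivity
    nlinarith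
  obtain ⟨τ, hτ, hτ0⟩ := intermediate_value_Icc' hμ.le hcont.continuousOn
    (show (0 : ℝ) ∈ Set.Icc (hypH μ μ) (hypH μ 0) from ⟨h1, by rw [h0]; exact hμ.le⟩)
  have hpos : 0 < τ := by
    rcases hτ.1.eq_or_lt with h | h
    · rw [← h, h0] at hτ0; linarith
    · exact h
  refine ⟨τ, hpos, hτ.2, hτ0, fun t ht htτ => ?_⟩
  rw [← hτ0]
  exact hanti ⟨ht, by linarith [hτ.2]⟩ ⟨hpos.le, by linarith [hτ.2]⟩ htτ

/-- `g` is a positive increasing solution on `(0, R]` of the radial equation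
`(r g')' = (μ² / r - lam r) g`, with `g(0) = 0`, `g'(R) = 0` and derivative `p`. -/
structure IsRadialProfile (μ lam R : ℝ) (g p : ℝ → ℝ) : Prop where
  hasDerivAt : ∀ r, 0 < r → HasDerivAt g (p r) r
  contDiffOn : ContDiffOn ℝ (⊤ : ℕ∞) p (Set.Ioi 0)
  continuous : Continuous g
  map_zero : g 0 = 0
  pos : ∀ r, 0 < r → r ≤ R → 0 < g r
  deriv_pos : ∀ r, 0 < r → r < R → 0 < p r
  deriv_end : p R = 0
  hasDerivAt_mul : ∀ r, 0 < r → HasDerivAt (fun s => s * p s) ((μ ^ 2 / r - lam * r) * g r) r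
  continuousOn_mul : ContinuousOn (fun s => s * p s) (Set.Ici 0)

lemma exists_isRadialProfile {μ R : ℝ} (hμ : 0 < μ) (hμ2 : μ ≤ 1 / 2) (hR : 0 < R) :
    ∃ (lam : ℝ) (g p : ℝ → ℝ), 0 < lam ∧ lam ≤ 4 * μ / R ^ 2 ∧ IsRadialProfile μ lam R g p := by
  obtain ⟨τ, hτ, hτμ, hH0, hHpos⟩ := exists_hypH_zero hμ hμ2
  have hHcont : ContDiff ℝ (⊤ : ℕ∞) (hypH μ) := by
    have h1 := contDiff_hypF (b := μ + 1) (by linarith)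
    have h2 := contDiff_hypF (b := μ + 2) (by linarith)
    unfold hypH
    fun_prop
  have hFcont := contDiff_hypF (b := μ + 1) (by linarith)
  have hsq : ∀ r, HasDerivAt (fun r => τ * (r / R) ^ 2) (2 * τ * r / R ^ 2) r := by
    intro r
    refine ((((hasDerivAt_id r).div_const R).fun_pow 2).const_mul τ).congr_deriv ?_
    simp only [id]
    push_cast
    field_simp
  have hmulp : ∀ r, 0 ≤ r → r * (r ^ (μ - 1) * hypH μ (τ * (r / R) ^ 2))
      = r ^ μ * hypH μ (τ * (r / R) ^ 2) := by
    intro r hr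
    rcases hr.eq_or_lt with rfl | hr
    · simp [Real.zero_rpow hμ.ne']
    · rw [Real.rpow_sub_one hr.ne']
      field_simp
  have hτle : ∀ r, 0 < r → r ≤ R → τ * (r / R) ^ 2 ≤ 1 := by
    intro r h0 h1
    have : r / R ≤ 1 := (div_le_one hR).2 h1
    have h2 : (r / R) ^ 2 ≤ 1 := pow_le_one₀ (by positivity) this
    nlinarith
  refine ⟨4 * τ / R ^ 2, fun r => r ^ μ * hypF (μ + 1) (τ * (r / R) ^ 2),
    fun r => r ^ (μ - 1) * hypH μ (τ * (r / R) ^ 2), by positivity, by gcongr, ?_⟩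
  constructor
  · intro r hr
    have h1 := Real.hasDerivAt_rpow_const (p := μ) (Or.inl hr.ne')
    have h2 := (hasDerivAt_hypF (b := μ + 1) (by linarith) (τ * (r / R) ^ 2)).comp r (hsq r)
    refine (h1.mul h2).congr_deriv ?_
    rw [show r ^ μ = r ^ (μ - 1) * r by rw [Real.rpow_sub_one hr.ne']; field_simp]
    unfold hypH
    simp only [Function.comp]
    rw [show μ + 1 + 1 = μ + 2 by ring]
    field_simp
  · refine ContDiffOn.mul (fun r hr => ?_) (hHcont.comp (by fun_prop)).contDiffOn
    exact (Real.contDiffAt_rpow_const_of_ne (ne_of_gt hr)).contDiffWithinAt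
  · have := hFcont.continuous
    have h2 : Continuous fun r : ℝ => r ^ μ := Real.continuous_rpow_const hμ.le
    fun_prop
  · simp [Real.zero_rpow hμ.ne']
  · intro r h0 h1
    exact mul_pos (Real.rpow_pos_of_pos h0 _)
      (hypF_pos (by linarith) (by positivity) (hτle r h0 h1))
  · intro r h0 h1
    refine mul_pos (Real.rpow_pos_of_pos h0 _) (hHpos _ (by positivity) ?_)
    have h2 : (r / R) ^ 2 < 1 := pow_lt_one₀ (by positivity) ((div_lt_one hR).2 h1) two_ne_zero
    nlinarith
  · simp [hR.ne', hH0]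
  · intro r hr
    have h1 := Real.hasDerivAt_rpow_const (p := μ) (Or.inl hr.ne')
    have h2 := (hasDerivAt_hypH hμ (τ * (r / R) ^ 2)).comp r (hsq r)
    have h3 := h1.mul h2
    have h4 : HasDerivAt (fun s => s * (s ^ (μ - 1) * hypH μ (τ * (s / R) ^ 2))) _ r :=
      h3.congr_of_eventuallyEq (by
        filter_upwards [lt_mem_nhds hr] with s hs
        exact hmulp s hs.le)
    refine h4.congr_deriv ?_
    rw [show r ^ μ = r ^ (μ - 1) * r by rw [Real.rpow_sub_one hr.ne']; field_simp]
    unfold hypH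
    simp only [Function.comp]
    field_simp
    ring
  · have h1 := hHcont.continuous
    have h2 : Continuous fun r : ℝ => r ^ μ := Real.continuous_rpow_const hμ.le
    exact ContinuousOn.congr
      (by fun_prop : Continuous fun r => r ^ μ * hypH μ (τ * (r / R) ^ 2)).continuousOn
      fun r hr => hmulp r hr

/-- The energy density of the function `g(min r R) e^{ikθ}`, with angular contribution `μ²`. -/
noncomputable def radialEnergy (μ R : ℝ) (g p : ℝ → ℝ) (r : ℝ) : ℝ :=
  (if r < R then p r ^ 2 else 0) + μ ^ 2 * g (min r R) ^ 2 / r ^ 2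

namespace IsRadialProfile

variable {μ lam R : ℝ} {g p : ℝ → ℝ}

lemma strictMonoOn (h : IsRadialProfile μ lam R g p) : StrictMonoOn g (Set.Icc 0 R) := by
  refine strictMonoOn_of_deriv_pos (convex_Icc 0 R) h.continuous.continuousOn fun r hr => ?_
  rw [interior_Icc] at hr
  rw [(h.hasDerivAt r hr.1).deriv]
  exact h.deriv_pos r hr.1 hr.2

lemma hasDerivAt_deriv (h : IsRadialProfile μ lam R g p) {r : ℝ} (hr : 0 < r) :
    HasDerivAt p (((μ ^ 2 / r - lam * r) * g r - p r) / r) r := by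
  have h1 := (h.hasDerivAt_mul r hr).div (hasDerivAt_id r) hr.ne'
  have h2 := h1.congr_of_eventuallyEq (f₁ := p) (by
    filter_upwards [lt_mem_nhds hr] with s hs
    simp [hs.ne'])
  refine h2.congr_deriv ?_
  simp only [id]
  field_simp

lemma radialEnergy_of_le (h : IsRadialProfile μ lam R g p) {r : ℝ} (hr : r ≤ R) :
    radialEnergy μ R g p r = p r ^ 2 + μ ^ 2 * g r ^ 2 / r ^ 2 := by
  rw [radialEnergy, min_eq_left hr]
  rcases hr.lt_or_eq with h1 | rfl
  · rw [if_pos h1]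
  · simp [h.deriv_end]

lemma radialEnergy_nonneg (r : ℝ) : 0 ≤ radialEnergy μ R g p r := by
  unfold radialEnergy
  split_ifs <;> positivity

lemma antitoneOn_radialEnergy (h : IsRadialProfile μ lam R g p) (hμ1 : μ ^ 2 ≤ 1)
    (hlam : 0 ≤ lam) : AntitoneOn (radialEnergy μ R g p) (Set.Ioc 0 R) := by
  have key : AntitoneOn (fun r => p r ^ 2 + μ ^ 2 * g r ^ 2 / r ^ 2) (Set.Ioc 0 R) := by
    have hd : ∀ r, 0 < r → HasDerivAt (fun r => p r ^ 2 + μ ^ 2 * g r ^ 2 / r ^ 2) _ r :=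
      fun r hr => ((h.hasDerivAt_deriv hr).fun_pow 2).add
        ((((h.hasDerivAt r hr).fun_pow 2).const_mul (μ ^ 2)).div
          ((hasDerivAt_id r).fun_pow 2) (pow_ne_zero 2 hr.ne'))
    refine antitoneOn_of_deriv_nonpos (convex_Ioc 0 R)
      (fun r hr => (hd r hr.1).continuousAt.continuousWithinAt)
      (fun r hr => ?_) fun r hr => ?_
    · rw [interior_Ioc] at hr
      exact (hd r hr.1).differentiableAt.differentiableWithinAt
    · rw [interior_Ioc] at hr
      have h0 := hr.1
      rw [(hd r h0).deriv]
      have hp := (h.deriv_pos r h0 hr.2).le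
      have hg := (h.pos r h0 hr.2.le).le
      have e1 : 0 ≤ lam * g r * p r := by positivity
      have e2 : 0 ≤ (p r - μ ^ 2 * (g r / r)) ^ 2 + μ ^ 2 * (1 - μ ^ 2) * (g r / r) ^ 2 := by
        have : 0 ≤ 1 - μ ^ 2 := by linarith
        positivity
      have e3 : 0 ≤ 2 / r * ((p r - μ ^ 2 * (g r / r)) ^ 2
          + μ ^ 2 * (1 - μ ^ 2) * (g r / r) ^ 2) + 2 * (lam * g r * p r) := by positivity
      simp only [id]
      refine le_of_eq_of_le ?_ (neg_nonpos.2 e3)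
      push_cast
      field_simp
      ring
  refine key.congr fun r hr => (h.radialEnergy_of_le hr.2).symm

lemma radialEnergy_le_of_ge (hR : 0 < R) {r : ℝ} (hr : R ≤ r) :
    radialEnergy μ R g p r ≤ μ ^ 2 * g R ^ 2 / R ^ 2 := by
  rw [radialEnergy, if_neg (not_lt.2 hr), min_eq_right hr, zero_add]
  gcongr

lemma le_radialEnergy_of_le (h : IsRadialProfile μ lam R g p) (hμ1 : μ ^ 2 ≤ 1)
    (hlam : 0 ≤ lam) {r : ℝ} (h0 : 0 < r) (hr : r ≤ R) :
    μ ^ 2 * g R ^ 2 / R ^ 2 ≤ radialEnergy μ R g p r := by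
  have := h.antitoneOn_radialEnergy hμ1 hlam ⟨h0, hr⟩ ⟨h0.trans_le hr, le_rfl⟩ hr
  rw [h.radialEnergy_of_le le_rfl, h.deriv_end] at this
  simpa using this

lemma intervalIntegrable_deriv (h : IsRadialProfile μ lam R g p) (hR : 0 < R) :
    IntervalIntegrable p volume 0 R := by
  refine intervalIntegral.intervalIntegrable_deriv_of_nonneg (g := g)
    h.continuous.continuousOn ?_ ?_
  · intro r hr
    rw [min_eq_left hR.le] at hr
    exact h.hasDerivAt r hr.1
  · intro r hr
    rw [min_eq_left hR.le, max_eq_right hR.le] at hr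
    exact (h.deriv_pos r hr.1 hr.2).le

lemma integral_radialEnergy (h : IsRadialProfile μ lam R g p) (hR : 0 < R) :
    IntervalIntegrable (fun r => r * radialEnergy μ R g p r) volume 0 R ∧
    ∫ r in (0)..R, r * radialEnergy μ R g p r = lam * ∫ r in (0)..R, r * g r ^ 2 := by
  have hc : Continuous fun r => lam * (r * g r ^ 2) := by
    have := h.continuous
    fun_prop
  have hW : ContinuousOn (fun r => r * p r * g r + ∫ s in (0)..r, lam * (s * g s ^ 2))
      (Set.Icc 0 R) :=
    (((h.continuousOn_mul.mono Set.Icc_subset_Ici_self)).mul h.continuous.continuousOn).add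
      (intervalIntegral.differentiable_integral_of_continuous hc).continuous.continuousOn
  have hd : ∀ r ∈ Set.Ioo 0 R,
      HasDerivAt (fun r => r * p r * g r + ∫ s in (0)..r, lam * (s * g s ^ 2))
        (r * radialEnergy μ R g p r) r := by
    intro r hr
    have h0 := hr.1
    refine (((h.hasDerivAt_mul r h0).mul (h.hasDerivAt r h0)).add
      (hc.integral_hasStrictDerivAt 0 r).hasDerivAt).congr_deriv ?_
    rw [h.radialEnergy_of_le hr.2.le]
    field_simp
    ring
  have hint : IntervalIntegrable (fun r => r * radialEnergy μ R g p r) volume 0 R := by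
    refine intervalIntegral.intervalIntegrable_deriv_of_nonneg (by rwa [Set.uIcc_of_le hR.le])
      (by rwa [min_eq_left hR.le, max_eq_right hR.le]) fun r hr => ?_
    rw [min_eq_left hR.le] at hr
    exact mul_nonneg hr.1.le (radialEnergy_nonneg r)
  refine ⟨hint, ?_⟩
  rw [intervalIntegral.integral_eq_sub_of_hasDerivAt_of_le hR.le hW hd hint]
  simp [h.deriv_end]

end IsRadialProfile

/-- A one-dimensional Picone (Jacobi–Barta) inequality for the radial operator. -/
lemma IsRadialProfile.picone {μ lam R : ℝ} {g p : ℝ → ℝ} (h : IsRadialProfile μ lam R g p)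
    (hR : 0 < R) {U U' : ℝ → ℂ} (hU : ∀ r, HasDerivAt U (U' r) r) (hU' : Continuous U')
    {ε : ℝ} (hε : 0 < ε) (hzero : ∀ r, |r| < ε → U r = 0) :
    0 ≤ ∫ r in (0)..R, (r * ‖U' r‖ ^ 2 - lam * (r * ‖U r‖ ^ 2) + μ ^ 2 * (‖U r‖ ^ 2 / r)) := by
  have hUc : Continuous U := continuous_iff_continuousAt.2 fun r => (hU r).continuousAt
  have near : ∀ᶠ r in nhds (0 : ℝ), U r = 0 := by
    filter_upwards [Metric.ball_mem_nhds (0 : ℝ) hε] with r hr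
    exact hzero r (by simpa using hr)
  have hdiv : Continuous fun r => ‖U r‖ ^ 2 / r := by
    refine continuous_iff_continuousAt.2 fun r => ?_
    by_cases hr : r = 0
    · subst hr
      refine (continuousAt_const (y := (0 : ℝ))).congr ?_
      filter_upwards [near] with r hr
      simp [hr]
    · exact ContinuousAt.div (by fun_prop) continuousAt_id hr
  have hφ : Continuous fun r =>
      r * ‖U' r‖ ^ 2 - lam * (r * ‖U r‖ ^ 2) + μ ^ 2 * (‖U r‖ ^ 2 / r) := by fun_prop
  have hW : ∀ r, 0 < r → r ≤ R → HasDerivAt (fun r => r * p r / g r * ‖U r‖ ^ 2) _ r :=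
    fun r h0 h1 => ((h.hasDerivAt_mul r h0).div (h.hasDerivAt r h0) (h.pos r h0 h1).ne').mul
      (hU r).norm_sq
  have key := intervalIntegral.sub_le_integral_of_hasDeriv_right_of_le hR.le
    (g := fun r => r * p r / g r * ‖U r‖ ^ 2) (g' := _) (φ := _) ?_
    (fun r hr => (hW r hr.1 hr.2.le).hasDerivWithinAt)
    (hφ.integrableOn_Icc) (fun r hr => ?_)
  · simpa [h.deriv_end] using key
  · intro r hr
    rcases hr.1.eq_or_lt with rfl | h0
    · refine ContinuousAt.continuousWithinAt ?_
      refine (continuousAt_const (y := (0 : ℝ))).congr ?_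
      filter_upwards [near] with r hr
      simp [hr]
    · exact (hW r h0 hr.2).continuousAt.continuousWithinAt
  · have hr0 := hr.1
    have hg := h.pos r hr0 hr.2.le
    have hp := h.deriv_pos r hr0 hr.2
    have hin : inner ℝ (U r) (U' r) ≤ ‖U r‖ * ‖U' r‖ := real_inner_le_norm _ _
    have e1 : r * p r / g r * (2 * inner ℝ (U r) (U' r)) ≤
        r * p r / g r * (2 * (‖U r‖ * ‖U' r‖)) := by gcongr
    have e2 : 0 ≤ r * (p r / g r * ‖U r‖ - ‖U' r‖) ^ 2 := by positivity
    have e3 : ((μ ^ 2 / r - lam * r) * g r * g r - r * p r * p r) / g r ^ 2 * ‖U r‖ ^ 2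
        = μ ^ 2 * (‖U r‖ ^ 2 / r) - lam * (r * ‖U r‖ ^ 2) - r * (p r / g r * ‖U r‖) ^ 2 := by
      field_simp
    have e4 : r * p r / g r * (2 * (‖U r‖ * ‖U' r‖)) =
        r * (2 * (p r / g r * ‖U r‖) * ‖U' r‖) := by ring
    rw [e3, Pi.div_apply]
    nlinarith

/-- The magnetic Wirtinger inequality on the circle. -/
lemma magnetic_wirtinger {μ ν : ℝ} (hμ : ∀ n : ℤ, μ ^ 2 ≤ (ν - n) ^ 2) {f f' : ℝ → ℂ}
    (hf : ∀ θ, HasDerivAt f (f' θ) θ) (hf' : Continuous f')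
    (hper : f Real.pi = f (-Real.pi)) :
    μ ^ 2 * ∫ θ in (-Real.pi)..Real.pi, ‖f θ‖ ^ 2 ≤
      ∫ θ in (-Real.pi)..Real.pi, ‖f' θ - Complex.I * ν * f θ‖ ^ 2 := by
  have hfc : Continuous f := continuous_iff_continuousAt.2 fun r => (hf r).continuousAt
  have hab : -Real.pi < Real.pi := by linarith [Real.pi_pos]
  have hπ : (Real.pi : ℂ) ≠ 0 := by exact_mod_cast Real.pi_ne_zero
  have hLp : ∀ F : ℝ → ℂ, Continuous F →
      MemLp F 2 (volume.restrict (Set.Ioc (-Real.pi) Real.pi)) := by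
    intro F hF
    rw [memLp_two_iff_integrable_sq_norm hF.aestronglyMeasurable]
    exact (by fun_prop : Continuous fun θ => ‖F θ‖ ^ 2).integrableOn_Ioc
  set G : ℝ → ℂ := fun θ => f' θ - Complex.I * ν * f θ with hG
  have hGc : Continuous G := by fun_prop
  have hcoef' : ∀ n : ℤ, fourierCoeffOn hab f' n = Complex.I * n * fourierCoeffOn hab f n := by
    intro n
    by_cases hn : n = 0
    · subst hn
      rw [fourierCoeffOn_eq_integral]
      simp only [neg_zero, fourier_zero, one_smul]
      rw [intervalIntegral.integral_eq_sub_of_hasDerivAt (fun θ _ => hf θ)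
        (hf'.intervalIntegrable _ _), hper]
      simp
    · rw [fourierCoeffOn_of_hasDerivAt hab hn (fun θ _ => hf θ) (hf'.intervalIntegrable _ _), hper]
      have : (n : ℂ) ≠ 0 := by exact_mod_cast hn
      push_cast
      field_simp
      ring_nf
  have hcoef : ∀ n : ℤ, fourierCoeffOn hab G n =
      Complex.I * (n - ν) * fourierCoeffOn hab f n := by
    intro n
    have h1 : fourierCoeffOn hab G n =
        fourierCoeffOn hab f' n - Complex.I * ν * fourierCoeffOn hab f n := by
      rw [fourierCoeffOn_eq_integral, fourierCoeffOn_eq_integral, fourierCoeffOn_eq_integral]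
      have hc : Continuous fun θ : ℝ => fourier (T := Real.pi - -Real.pi) (-n) (θ : AddCircle _) :=
        (map_continuous _).comp (AddCircle.continuous_mk' _)
      simp only [hG, smul_sub]
      have i1 : IntervalIntegrable (fun θ : ℝ => fourier (T := Real.pi - -Real.pi) (-n)
          (θ : AddCircle _) • f' θ) volume (-Real.pi) Real.pi :=
        (hc.smul hf').intervalIntegrable _ _
      have i2 : IntervalIntegrable (fun θ : ℝ => fourier (T := Real.pi - -Real.pi) (-n)
          (θ : AddCircle _) • (Complex.I * ν * f θ)) volume (-Real.pi) Real.pi :=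
        (hc.smul (by fun_prop)).intervalIntegrable _ _
      rw [intervalIntegral.integral_sub i1 i2, smul_sub]
      congr 1
      rw [mul_smul_comm, ← intervalIntegral.integral_const_mul]
      congr 1
      refine intervalIntegral.integral_congr fun θ _ => ?_
      simp only [smul_eq_mul]
      ring
    rw [h1, hcoef']
    ring
  have s1 := hasSum_sq_fourierCoeffOn hab (hLp f hfc)
  have s2 := hasSum_sq_fourierCoeffOn hab (hLp G hGc)
  have hle := hasSum_le (fun n => ?_) (s1.mul_left (μ ^ 2)) s2
  · rw [smul_eq_mul, smul_eq_mul, mul_left_comm] at hle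
    exact le_of_mul_le_mul_left hle (inv_pos.2 (by linarith))
  · rw [hcoef, norm_mul, norm_mul, Complex.norm_I, one_mul, mul_pow]
    have : ‖(n : ℂ) - ν‖ ^ 2 = (ν - n) ^ 2 := by
      rw [show (n : ℂ) - ν = ((n - ν : ℝ) : ℂ) by push_cast; ring, Complex.norm_real,
        Real.norm_eq_abs, sq_abs]
      ring
    rw [this]
    exact mul_le_mul_of_nonneg_right (hμ n) (sq_nonneg _)

/-- Polar coordinates around `x₀`. -/
noncomputable def polarPt (x₀ : EuclideanSpace ℝ (Fin 2)) (r θ : ℝ) : EuclideanSpace ℝ (Fin 2) :=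
  x₀ + r • !₂[Real.cos θ, Real.sin θ]

lemma norm_cos_sin (θ : ℝ) : ‖!₂[Real.cos θ, Real.sin θ]‖ = 1 := by
  rw [EuclideanSpace.norm_eq]
  simp

lemma continuous_polarPt (x₀ : EuclideanSpace ℝ (Fin 2)) :
    Continuous fun q : ℝ × ℝ => polarPt x₀ q.1 q.2 := by
  unfold polarPt
  have : Continuous fun q : ℝ × ℝ => ![Real.cos q.2, Real.sin q.2] := by
    refine continuous_pi fun i => ?_
    fin_cases i
    · exact Real.continuous_cos.comp continuous_snd
    · exact Real.continuous_sin.comp continuous_snd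
  have h2 : Continuous fun q : ℝ × ℝ => !₂[Real.cos q.2, Real.sin q.2] :=
    (PiLp.continuous_toLp 2 _).comp this
  fun_prop

lemma norm_polarPt_sub (x₀ : EuclideanSpace ℝ (Fin 2)) (r θ : ℝ) :
    ‖polarPt x₀ r θ - x₀‖ = |r| := by
  rw [polarPt, add_sub_cancel_left, norm_smul, norm_cos_sin, mul_one, Real.norm_eq_abs]

lemma setIntegral_ball_polar (x₀ : EuclideanSpace ℝ (Fin 2)) {R : ℝ} (hR : 0 < R)
    {f : EuclideanSpace ℝ (Fin 2) → ℝ} (hf : Continuous f) :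
    ∫ x in Metric.ball x₀ R, f x =
      ∫ r in (0)..R, ∫ θ in (-Real.pi)..Real.pi, r * f (polarPt x₀ r θ) := by
  have hmp : MeasurePreserving
      (fun x : EuclideanSpace ℝ (Fin 2) => MeasurableEquiv.finTwoArrow
        ((MeasurableEquiv.toLp 2 (Fin 2 → ℝ)).symm x)) volume volume :=
    (volume_preserving_finTwoArrow ℝ).comp
      (EuclideanSpace.volume_preserving_symm_measurableEquiv_toLp (Fin 2))
  let e : EuclideanSpace ℝ (Fin 2) ≃ᵐ ℝ × ℝ :=
    (MeasurableEquiv.toLp 2 (Fin 2 → ℝ)).symm.trans MeasurableEquiv.finTwoArrow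
  have hmp' : MeasurePreserving e.symm volume volume := MeasurePreserving.symm e hmp
  set F := (Metric.ball x₀ R).indicator f
  have hsymm : ∀ r θ : ℝ, x₀ + e.symm (polarCoord.symm (r, θ)) = polarPt x₀ r θ := by
    intro r θ
    unfold polarPt
    congr 1
    ext i
    fin_cases i <;> simp [e]
  have hmem : ∀ r θ : ℝ, polarPt x₀ r θ ∈ Metric.ball x₀ R ↔ |r| < R := by
    intro r θ
    rw [mem_ball_iff_norm, norm_polarPt_sub]
  have hc : Continuous fun q : ℝ × ℝ => q.1 * f (polarPt x₀ q.1 q.2) :=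
    continuous_fst.mul (hf.comp (continuous_polarPt x₀))
  have hab : -Real.pi ≤ Real.pi := by linarith [Real.pi_pos]
  calc ∫ x in Metric.ball x₀ R, f x = ∫ x, F x :=
        (integral_indicator measurableSet_ball).symm
    _ = ∫ x, F (x₀ + x) := (integral_add_left_eq_self F x₀).symm
    _ = ∫ q : ℝ × ℝ, F (x₀ + e.symm q) :=
        (hmp'.integral_comp' (fun x => F (x₀ + x))).symm
    _ = ∫ q in polarCoord.target, q.1 • F (x₀ + e.symm (polarCoord.symm q)) :=
        (integral_comp_polarCoord_symm fun q => F (x₀ + e.symm q)).symm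
    _ = ∫ q in Set.Ioi 0 ×ˢ Set.Ioo (-Real.pi) Real.pi,
          (Set.Iio R ×ˢ Set.univ).indicator (fun q : ℝ × ℝ => q.1 * f (polarPt x₀ q.1 q.2)) q := by
        rw [polarCoord_target]
        refine setIntegral_congr_fun (measurableSet_Ioi.prod measurableSet_Ioo) fun q hq => ?_
        have hq0 : 0 < q.1 := hq.1
        have := hsymm q.1 q.2
        simp only [Prod.mk.eta] at this
        have hm := hmem q.1 q.2
        rw [abs_of_pos hq0] at hm
        by_cases hqR : q.1 < R
        · rw [this, smul_eq_mul, show F _ = _ from Set.indicator_of_mem (hm.2 hqR) f,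
            Set.indicator_of_mem (show q ∈ Set.Iio R ×ˢ Set.univ from ⟨hqR, Set.mem_univ _⟩)]
        · rw [this, smul_eq_mul, show F _ = _ from Set.indicator_of_notMem (mt hm.1 hqR) f,
            Set.indicator_of_notMem fun hq' => hqR hq'.1, mul_zero]
    _ = ∫ q in Set.Ioo 0 R ×ˢ Set.Ioo (-Real.pi) Real.pi, q.1 * f (polarPt x₀ q.1 q.2) := by
        rw [setIntegral_indicator (measurableSet_Iio.prod MeasurableSet.univ), Set.prod_inter_prod,
          Set.inter_univ, Set.Ioi_inter_Iio]
    _ = ∫ r in Set.Ioo 0 R, ∫ θ in Set.Ioo (-Real.pi) Real.pi, r * f (polarPt x₀ r θ) := by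
        rw [Measure.volume_eq_prod, setIntegral_prod]
        exact (hc.continuousOn.integrableOn_compact (isCompact_Icc.prod isCompact_Icc)).mono_set
          (Set.prod_mono Set.Ioo_subset_Icc_self Set.Ioo_subset_Icc_self)
    _ = _ := by
        rw [intervalIntegral.integral_of_le hR.le, integral_Ioc_eq_integral_Ioo]
        refine setIntegral_congr_fun measurableSet_Ioo fun r _ => ?_
        rw [intervalIntegral.integral_of_le hab, integral_Ioc_eq_integral_Ioo]

lemma AB_zero_apply (x₀ : EuclideanSpace ℝ (Fin 2)) (ν : ℝ) (x : EuclideanSpace ℝ (Fin 2)) :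
    AB x₀ ν x 0 = -ν * (x 1 - x₀ 1) / ‖x - x₀‖ ^ 2 := by simp [AB]

lemma AB_one_apply (x₀ : EuclideanSpace ℝ (Fin 2)) (ν : ℝ) (x : EuclideanSpace ℝ (Fin 2)) :
    AB x₀ ν x 1 = ν * (x 0 - x₀ 0) / ‖x - x₀‖ ^ 2 := by simp [AB]

lemma magGradSq_nonneg (A : EuclideanSpace ℝ (Fin 2) → Fin 2 → ℝ)
    (u : EuclideanSpace ℝ (Fin 2) → ℂ) (x : EuclideanSpace ℝ (Fin 2)) : 0 ≤ magGradSq A u x :=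
  Finset.sum_nonneg fun _ _ => by positivity

lemma magGradSq_eq_zero_of_eventually (A : EuclideanSpace ℝ (Fin 2) → Fin 2 → ℝ)
    {u : EuclideanSpace ℝ (Fin 2) → ℂ} {x : EuclideanSpace ℝ (Fin 2)}
    (h : u =ᶠ[nhds x] 0) : magGradSq A u x = 0 := by
  have h1 : fderiv ℝ u x = 0 := by rw [h.fderiv_eq]; simp
  have h2 : u x = 0 := h.eq_of_nhds
  simp [magGradSq, h1, h2]

lemma VanishesNear.eventually {x₀ : EuclideanSpace ℝ (Fin 2)} {u : EuclideanSpace ℝ (Fin 2) → ℂ}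
    (h : VanishesNear x₀ u) : u =ᶠ[nhds x₀] 0 := by
  obtain ⟨ε, hε, h⟩ := h
  filter_upwards [Metric.ball_mem_nhds x₀ hε] with x hx
  exact h x hx

lemma continuous_magGradSq (x₀ : EuclideanSpace ℝ (Fin 2)) (ν : ℝ)
    {u : EuclideanSpace ℝ (Fin 2) → ℂ} (hu : ContDiff ℝ (⊤ : ℕ∞) u) (hv : VanishesNear x₀ u) :
    Continuous (magGradSq (AB x₀ ν) u) := by
  have hf : Continuous (fderiv ℝ u) := hu.continuous_fderiv (by simp)
  have hc := hu.continuous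
  refine continuous_iff_continuousAt.2 fun x => ?_
  by_cases hx : x = x₀
  · subst hx
    refine (continuousAt_const (y := (0 : ℝ))).congr ?_
    filter_upwards [hv.eventually.eventually_nhds] with y hy
    exact (magGradSq_eq_zero_of_eventually _ hy).symm
  · have hne : ‖x - x₀‖ ^ 2 ≠ 0 := by simpa [sub_eq_zero] using hx
    have h0 : ContinuousAt (fun y => AB x₀ ν y 0) x := by
      simp only [AB_zero_apply]
      exact ContinuousAt.div (by fun_prop) (by fun_prop) hne
    have h1 : ContinuousAt (fun y => AB x₀ ν y 1) x := by
      simp only [AB_one_apply]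
      exact ContinuousAt.div (by fun_prop) (by fun_prop) hne
    unfold magGradSq
    simp only [Fin.sum_univ_two]
    fun_prop

lemma cos_sin_eq (a b : ℝ) :
    !₂[a, b] = a • EuclideanSpace.single (0 : Fin 2) (1 : ℝ)
      + b • EuclideanSpace.single (1 : Fin 2) (1 : ℝ) := by
  ext i
  fin_cases i <;> simp

lemma norm_sq_rotation {c s : ℝ} (h : s ^ 2 + c ^ 2 = 1) (a b : ℂ) :
    ‖a‖ ^ 2 + ‖b‖ ^ 2 = ‖c • a + s • b‖ ^ 2 + ‖-s • a + c • b‖ ^ 2 := by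
  simp only [Complex.sq_norm, Complex.normSq_apply, Complex.add_re, Complex.add_im,
    Complex.real_smul, Complex.mul_re, Complex.mul_im, Complex.ofReal_re, Complex.ofReal_im]
  linear_combination (-(a.re ^ 2 + a.im ^ 2 + b.re ^ 2 + b.im ^ 2)) * h

lemma magGradSq_polar (x₀ : EuclideanSpace ℝ (Fin 2)) (ν : ℝ) (u : EuclideanSpace ℝ (Fin 2) → ℂ)
    {r : ℝ} (hr : 0 < r) (θ : ℝ) :
    r * magGradSq (AB x₀ ν) u (polarPt x₀ r θ) =
      r * ‖fderiv ℝ u (polarPt x₀ r θ) !₂[Real.cos θ, Real.sin θ]‖ ^ 2 +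
      ‖fderiv ℝ u (polarPt x₀ r θ) (r • !₂[-Real.sin θ, Real.cos θ])
        - Complex.I * ν * u (polarPt x₀ r θ)‖ ^ 2 / r := by
  have hA0 : AB x₀ ν (polarPt x₀ r θ) 0 = -ν * Real.sin θ / r := by
    rw [AB_zero_apply, norm_polarPt_sub, sq_abs]
    simp [polarPt]
    field_simp
  have hA1 : AB x₀ ν (polarPt x₀ r θ) 1 = ν * Real.cos θ / r := by
    rw [AB_one_apply, norm_polarPt_sub, sq_abs]
    simp [polarPt]
    field_simp
  have hsc := Real.sin_sq_add_cos_sq θ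
  have hsc' : (Real.sin θ : ℂ) ^ 2 + (Real.cos θ : ℂ) ^ 2 = 1 := by exact_mod_cast hsc
  have hrc : (r : ℂ) ≠ 0 := by exact_mod_cast hr.ne'
  rw [magGradSq, Fin.sum_univ_two, hA0, hA1, cos_sin_eq, cos_sin_eq]
  simp only [map_add, map_smul]
  set a := fderiv ℝ u (polarPt x₀ r θ) (EuclideanSpace.single 0 1)
  set b := fderiv ℝ u (polarPt x₀ r θ) (EuclideanSpace.single 1 1)
  set w := u (polarPt x₀ r θ)
  rw [norm_sq_rotation hsc]
  have e1 : Real.cos θ • (a - Complex.I * w * ((-ν * Real.sin θ / r : ℝ) : ℂ)) +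
      Real.sin θ • (b - Complex.I * w * ((ν * Real.cos θ / r : ℝ) : ℂ)) =
      Real.cos θ • a + Real.sin θ • b := by
    simp only [Complex.real_smul]
    push_cast
    ring
  have e2 : -Real.sin θ • (a - Complex.I * w * ((-ν * Real.sin θ / r : ℝ) : ℂ)) +
      Real.cos θ • (b - Complex.I * w * ((ν * Real.cos θ / r : ℝ) : ℂ)) =
      ((r : ℂ)⁻¹) * (r • (-Real.sin θ • a + Real.cos θ • b) - Complex.I * ν * w) := by
    simp only [Complex.real_smul]
    push_cast at hsc' ⊢
    field_simp
    linear_combination (-(Complex.I * w * ν)) * hsc'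
  rw [e1, e2, norm_mul, norm_inv, Complex.norm_real, Real.norm_eq_abs, abs_of_pos hr, mul_add]
  congr 1
  field_simp

lemma hasDerivAt_polar_radial (x₀ : EuclideanSpace ℝ (Fin 2)) {u : EuclideanSpace ℝ (Fin 2) → ℂ}
    (hu : Differentiable ℝ u) (r θ : ℝ) :
    HasDerivAt (fun r => u (polarPt x₀ r θ))
      (fderiv ℝ u (polarPt x₀ r θ) !₂[Real.cos θ, Real.sin θ]) r := by
  have h1 : HasDerivAt (fun r => polarPt x₀ r θ) !₂[Real.cos θ, Real.sin θ] r := by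
    simpa [polarPt] using
      (((hasDerivAt_id r).smul_const !₂[Real.cos θ, Real.sin θ]).const_add x₀)
  exact (hu _).hasFDerivAt.comp_hasDerivAt r h1

lemma hasDerivAt_polar_angular (x₀ : EuclideanSpace ℝ (Fin 2)) {u : EuclideanSpace ℝ (Fin 2) → ℂ}
    (hu : Differentiable ℝ u) (r θ : ℝ) :
    HasDerivAt (fun θ => u (polarPt x₀ r θ))
      (fderiv ℝ u (polarPt x₀ r θ) (r • !₂[-Real.sin θ, Real.cos θ])) θ := by
  have h1 : HasDerivAt (fun θ => polarPt x₀ r θ) (r • !₂[-Real.sin θ, Real.cos θ]) θ := by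
    unfold polarPt
    simp only [cos_sin_eq]
    exact ((((Real.hasDerivAt_cos θ).smul_const _).add
      ((Real.hasDerivAt_sin θ).smul_const _)).const_smul r).const_add x₀
  exact (hu _).hasFDerivAt.comp_hasDerivAt θ h1

/-- Lower bound for the magnetic Dirichlet energy on a disk centred at the pole. -/
lemma IsRadialProfile.le_energy_ball {μ lam R ν : ℝ} {g p : ℝ → ℝ}
    (h : IsRadialProfile μ lam R g p) (hR : 0 < R) (hμ : ∀ n : ℤ, μ ^ 2 ≤ (ν - n) ^ 2)
    (x₀ : EuclideanSpace ℝ (Fin 2)) {u : EuclideanSpace ℝ (Fin 2) → ℂ}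
    (hu : ContDiff ℝ (⊤ : ℕ∞) u) (hv : VanishesNear x₀ u) :
    lam * ∫ x in Metric.ball x₀ R, ‖u x‖ ^ 2 ≤
      ∫ x in Metric.ball x₀ R, magGradSq (AB x₀ ν) u x := by
  have hπ : -Real.pi ≤ Real.pi := by linarith [Real.pi_pos]
  have hc := hu.continuous
  have hf : Continuous (fderiv ℝ u) := hu.continuous_fderiv (by simp)
  have hdiff : Differentiable ℝ u := hu.differentiable (by simp)
  have hQ := continuous_magGradSq x₀ ν hu hv
  have hP := continuous_polarPt x₀
  obtain ⟨ε, hε, hv0⟩ := hv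
  have hzero : ∀ r θ, |r| < ε → u (polarPt x₀ r θ) = 0 := fun r θ hr =>
    hv0 _ (by rw [mem_ball_iff_norm, norm_polarPt_sub]; exact hr)
  set Ur : ℝ → ℝ → ℂ := fun r θ => fderiv ℝ u (polarPt x₀ r θ) !₂[Real.cos θ, Real.sin θ] with hUr
  have hUrc : Continuous fun q : ℝ × ℝ => Ur q.1 q.2 := by
    simp only [hUr, cos_sin_eq]
    exact (hf.comp hP).clm_apply (by fun_prop)
  have hdiv : Continuous fun q : ℝ × ℝ => ‖u (polarPt x₀ q.1 q.2)‖ ^ 2 / q.1 := by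
    refine continuous_iff_continuousAt.2 fun q => ?_
    by_cases hq : q.1 = 0
    · refine (continuousAt_const (y := (0 : ℝ))).congr ?_
      have : ∀ᶠ r in nhds q.1, |r| < ε := by
        rw [hq]
        filter_upwards [Metric.ball_mem_nhds (0 : ℝ) hε] with r hr
        simpa using hr
      filter_upwards [continuous_fst.continuousAt.eventually this] with r hr
      simp [hzero _ _ hr]
    · exact ContinuousAt.div (by fun_prop) continuousAt_fst hq
  set K : ℝ → ℝ → ℝ := fun r θ => r * ‖Ur r θ‖ ^ 2 - lam * (r * ‖u (polarPt x₀ r θ)‖ ^ 2)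
    + μ ^ 2 * (‖u (polarPt x₀ r θ)‖ ^ 2 / r) with hK
  have hKc : Continuous fun q : ℝ × ℝ => K q.1 q.2 := by fun_prop
  have hpar : ∀ {F : ℝ → ℝ → ℝ}, Continuous (fun q : ℝ × ℝ => F q.1 q.2) →
      IntervalIntegrable (fun r => ∫ θ in (-Real.pi)..Real.pi, F r θ) volume 0 R := fun hF =>
    (intervalIntegral.continuous_parametric_intervalIntegral_of_continuous' hF _ _
      ).intervalIntegrable _ _
  have c1 : Continuous fun q : ℝ × ℝ => q.1 * ‖u (polarPt x₀ q.1 q.2)‖ ^ 2 := by fun_prop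
  have c2 : Continuous fun q : ℝ × ℝ => q.1 * magGradSq (AB x₀ ν) u (polarPt x₀ q.1 q.2) := by
    fun_prop
  have hKpos : 0 ≤ ∫ r in (0)..R, ∫ θ in (-Real.pi)..Real.pi, K r θ := by
    rw [intervalIntegral_intervalIntegral_swap]
    · refine intervalIntegral.integral_nonneg hπ fun θ _ => ?_
      exact h.picone hR (fun r => hasDerivAt_polar_radial x₀ hdiff r θ)
        (hUrc.comp (by fun_prop : Continuous fun r : ℝ => (r, θ))) hε (fun r hr => hzero r θ hr)
    · rw [Set.uIoc_of_le hR.le, Set.uIoc_of_le hπ]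
      exact (hKc.continuousOn.integrableOn_compact (isCompact_Icc.prod isCompact_Icc)).mono_set
        (Set.prod_mono Set.Ioc_subset_Icc_self Set.Ioc_subset_Icc_self)
  rw [setIntegral_ball_polar x₀ hR (by fun_prop), setIntegral_ball_polar x₀ hR hQ, ← sub_nonneg,
    ← intervalIntegral.integral_const_mul,
    ← intervalIntegral.integral_sub (hpar c2) ((hpar c1).const_mul lam)]
  refine hKpos.trans (intervalIntegral.integral_mono_on_of_le_Ioo hR.le (hpar hKc)
    ((hpar c2).sub ((hpar c1).const_mul lam)) fun r hr => ?_)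
  have hr0 := hr.1
  have hθ : Continuous fun θ : ℝ => (r, θ) := by fun_prop
  set Uθ : ℝ → ℂ := fun θ => fderiv ℝ u (polarPt x₀ r θ) (r • !₂[-Real.sin θ, Real.cos θ])
    with hUθ
  have hUθc : Continuous Uθ := by
    simp only [hUθ, cos_sin_eq]
    exact (hf.comp (hP.comp hθ)).clm_apply (by fun_prop)
  have huc : Continuous fun θ => u (polarPt x₀ r θ) := hc.comp (hP.comp hθ)
  have hUrc' : Continuous fun θ => Ur r θ := hUrc.comp hθ
  have hw := magnetic_wirtinger hμ (fun θ => hasDerivAt_polar_angular x₀ hdiff r θ) hUθc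
    (by simp [polarPt])
  have i1 : IntervalIntegrable (fun θ => r * ‖Ur r θ‖ ^ 2) volume (-Real.pi) Real.pi :=
    (by fun_prop : Continuous fun θ => r * ‖Ur r θ‖ ^ 2).intervalIntegrable _ _
  have i2 : IntervalIntegrable (fun θ => lam * (r * ‖u (polarPt x₀ r θ)‖ ^ 2)) volume
      (-Real.pi) Real.pi :=
    (by fun_prop : Continuous fun θ => lam * (r * ‖u (polarPt x₀ r θ)‖ ^ 2)).intervalIntegrable _ _
  have i3 : IntervalIntegrable (fun θ => μ ^ 2 * (‖u (polarPt x₀ r θ)‖ ^ 2 / r)) volume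
      (-Real.pi) Real.pi :=
    (by fun_prop : Continuous fun θ => μ ^ 2 * (‖u (polarPt x₀ r θ)‖ ^ 2 / r)).intervalIntegrable
      _ _
  have i4 : IntervalIntegrable (fun θ => ‖Uθ θ - Complex.I * ν * u (polarPt x₀ r θ)‖ ^ 2 / r)
      volume (-Real.pi) Real.pi :=
    (by fun_prop : Continuous fun θ =>
      ‖Uθ θ - Complex.I * ν * u (polarPt x₀ r θ)‖ ^ 2 / r).intervalIntegrable _ _
  have e1 : ∫ θ in (-Real.pi)..Real.pi, r * magGradSq (AB x₀ ν) u (polarPt x₀ r θ) =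
      (∫ θ in (-Real.pi)..Real.pi, r * ‖Ur r θ‖ ^ 2) +
        (∫ θ in (-Real.pi)..Real.pi, ‖Uθ θ - Complex.I * ν * u (polarPt x₀ r θ)‖ ^ 2) / r := by
    simp only [magGradSq_polar x₀ ν u hr0]
    rw [intervalIntegral.integral_add i1 i4, intervalIntegral.integral_div]
  have e2 : ∫ θ in (-Real.pi)..Real.pi, lam * (r * ‖u (polarPt x₀ r θ)‖ ^ 2) =
      lam * ∫ θ in (-Real.pi)..Real.pi, r * ‖u (polarPt x₀ r θ)‖ ^ 2 :=
    intervalIntegral.integral_const_mul _ _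
  have e3 : ∫ θ in (-Real.pi)..Real.pi, μ ^ 2 * (‖u (polarPt x₀ r θ)‖ ^ 2 / r) =
      μ ^ 2 * ((∫ θ in (-Real.pi)..Real.pi, ‖u (polarPt x₀ r θ)‖ ^ 2) / r) := by
    rw [intervalIntegral.integral_const_mul, intervalIntegral.integral_div]
  simp only [hK]
  rw [intervalIntegral.integral_add (i1.sub i2) i3, intervalIntegral.integral_sub i1 i2, e1, e2,
    e3]
  have := div_le_div_of_nonneg_right hw hr0.le
  rw [mul_div_assoc] at this
  linarith

/-- Smooth approximations of a radial profile that vanish near the origin. -/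
lemma IsRadialProfile.exists_approx {μ lam R : ℝ} {g p : ℝ → ℝ}
    (h : IsRadialProfile μ lam R g p) (hR : 0 < R) :
    ∃ φ ψ : ℕ → ℝ → ℝ, (∀ n, ContDiff ℝ (⊤ : ℕ∞) (φ n)) ∧
      (∀ n r, HasDerivAt (φ n) (ψ n r) r) ∧
      (∀ n, ∃ ε > 0, ∀ r ≤ ε, φ n r = 0) ∧
      (∀ n r, ψ n r ^ 2 ≤ if r < R then p r ^ 2 else 0) ∧
      (∀ n r, 0 ≤ r → 0 ≤ φ n r ∧ φ n r ≤ g (min r R)) ∧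
      ∀ r, 0 ≤ r → Filter.Tendsto (fun n => φ n r) Filter.atTop (nhds (g (min r R))) := by
  set η : ℕ → ℝ → ℝ := fun n r => Real.smoothTransition ((n + 1) * r - 1) *
    Real.smoothTransition ((n + 1) * (R - r)) with hη
  have hn : ∀ n : ℕ, (0 : ℝ) < n + 1 := fun n => by positivity
  have hη0 : ∀ n r, 0 ≤ η n r := fun n r =>
    mul_nonneg (Real.smoothTransition.nonneg _) (Real.smoothTransition.nonneg _)
  have hη1 : ∀ n r, η n r ≤ 1 := fun n r =>
    mul_le_one₀ (Real.smoothTransition.le_one _) (Real.smoothTransition.nonneg _)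
      (Real.smoothTransition.le_one _)
  have hηl : ∀ (n : ℕ) r, r ≤ 1 / ((n : ℝ) + 1) → η n r = 0 := by
    intro n r hr
    rw [le_div_iff₀ (hn n)] at hr
    simp only [hη]
    rw [Real.smoothTransition.zero_of_nonpos (by linarith), zero_mul]
  have hηr : ∀ (n : ℕ) r, R ≤ r → η n r = 0 := by
    intro n r hr
    simp only [hη]
    rw [Real.smoothTransition.zero_of_nonpos (x := (n + 1) * (R - r))
      (mul_nonpos_of_nonneg_of_nonpos (hn n).le (by linarith)), mul_zero]
  have hηs : ∀ n, ContDiff ℝ (⊤ : ℕ∞) (η n) := fun n =>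
    (Real.smoothTransition.contDiff.comp (by fun_prop)).mul
      (Real.smoothTransition.contDiff.comp (by fun_prop))
  have hηlim : ∀ r, 0 < r → r < R → ∀ᶠ n : ℕ in Filter.atTop, η n r = 1 := by
    intro r h0 h1
    filter_upwards [tendsto_natCast_atTop_atTop.eventually_ge_atTop (2 / r),
      tendsto_natCast_atTop_atTop.eventually_ge_atTop (1 / (R - r))] with n hn1 hn2
    rw [div_le_iff₀ h0] at hn1
    rw [div_le_iff₀ (by linarith)] at hn2
    simp only [hη]
    rw [Real.smoothTransition.one_of_one_le (by linarith),
      Real.smoothTransition.one_of_one_le (by linarith), one_mul]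
  have hψs : ∀ n, ContDiff ℝ (⊤ : ℕ∞) fun r => η n r * p r := by
    refine fun n => contDiff_iff_contDiffAt.2 fun r => ?_
    rcases lt_or_ge 0 r with hr | hr
    · exact (hηs n).contDiffAt.mul (h.contDiffOn.contDiffAt (Ioi_mem_nhds hr))
    · refine (contDiffAt_const (c := (0 : ℝ))).congr_of_eventuallyEq ?_
      filter_upwards [Iio_mem_nhds (hr.trans_lt (one_div_pos.2 (hn n)))] with s hs
      rw [hηl n s (le_of_lt hs), zero_mul]
  have hψpos : ∀ n r, 0 ≤ η n r * p r := by
    intro n r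
    rcases le_or_gt r 0 with hr | hr
    · rw [hηl n r (hr.trans (one_div_pos.2 (hn n)).le), zero_mul]
    · rcases le_or_gt R r with h1 | h1
      · rw [hηr n r h1, zero_mul]
      · exact mul_nonneg (hη0 n r) (h.deriv_pos r hr h1).le
  have hψi : ∀ n a b, IntervalIntegrable (fun r => η n r * p r) volume a b := fun n a b =>
    (hψs n).continuous.intervalIntegrable a b
  have hd : ∀ n r, HasDerivAt (fun r => ∫ s in (0)..r, η n s * p s) (η n r * p r) r := fun n r =>
    ((hψs n).continuous.integral_hasStrictDerivAt 0 r).hasDerivAt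
  have hmin : ∀ n r, ∫ s in (0)..r, η n s * p s = ∫ s in (0)..(min r R), η n s * p s := by
    intro n r
    rcases le_total r R with hr | hr
    · rw [min_eq_left hr]
    · rw [min_eq_right hr, ← intervalIntegral.integral_add_adjacent_intervals (hψi n 0 R)
        (hψi n R r), add_eq_left]
      refine intervalIntegral.integral_zero_ae (Filter.Eventually.of_forall fun s hs => ?_)
      rw [Set.uIoc_of_le hr] at hs
      rw [hηr n s hs.1.le, zero_mul]
  have hpint : ∀ m, 0 ≤ m → m ≤ R → IntervalIntegrable p volume 0 m ∧
      ∫ s in (0)..m, p s = g m := by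
    intro m h0 h1
    have hi : IntervalIntegrable p volume 0 m := (h.intervalIntegrable_deriv hR).mono_set
      (by rw [Set.uIcc_of_le h0, Set.uIcc_of_le hR.le]; exact Set.Icc_subset_Icc_right h1)
    refine ⟨hi, ?_⟩
    rw [intervalIntegral.integral_eq_sub_of_hasDerivAt_of_le h0 h.continuous.continuousOn
      (fun r hr => h.hasDerivAt r hr.1) hi, h.map_zero, sub_zero]
  have hle : ∀ n s, 0 < s → s < R → η n s * p s ≤ p s := fun n s h0 h1 =>
    mul_le_of_le_one_left (h.deriv_pos s h0 h1).le (hη1 n s)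
  refine ⟨fun n r => ∫ s in (0)..r, η n s * p s, fun n r => η n r * p r, fun n => ?_, hd,
    fun n => ⟨1 / ((n : ℝ) + 1), one_div_pos.2 (hn n), fun r hr => ?_⟩, fun n r => ?_,
    fun n r hr => ⟨intervalIntegral.integral_nonneg hr fun s _ => hψpos n s, ?_⟩,
    fun r hr => ?_⟩
  · refine contDiff_infty_iff_deriv.2 ⟨fun r => (hd n r).differentiableAt, ?_⟩
    rw [funext fun r => (hd n r).deriv]
    exact hψs n
  · refine intervalIntegral.integral_zero_ae (Filter.Eventually.of_forall fun s hs => ?_)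
    rw [hηl n s (hs.2.trans (max_le (one_div_pos.2 (hn n)).le hr)), zero_mul]
  · split_ifs with h1
    · rw [mul_pow]
      exact mul_le_of_le_one_left (sq_nonneg _) (pow_le_one₀ (hη0 n r) (hη1 n r))
    · simp [hηr n r (not_lt.1 h1)]
  · have hm : 0 ≤ min r R := le_min hr hR.le
    refine (hmin n r).trans_le ?_
    rw [← (hpint _ hm (min_le_right _ _)).2]
    exact intervalIntegral.integral_mono_on_of_le_Ioo hm (hψi n _ _)
      (hpint _ hm (min_le_right _ _)).1
      fun s hs => hle n s hs.1 (hs.2.trans_le (min_le_right _ _))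
  · have hm : 0 ≤ min r R := le_min hr hR.le
    simp only [hmin _ r]
    rw [← (hpint _ hm (min_le_right _ _)).2]
    have hae : ∀ᵐ s : ℝ, s ∈ Set.uIoc 0 (min r R) → 0 < s ∧ s < R := by
      filter_upwards [Measure.ae_ne volume R] with s hs hs'
      rw [Set.uIoc_of_le hm] at hs'
      exact ⟨hs'.1, lt_of_le_of_ne (hs'.2.trans (min_le_right _ _)) hs⟩
    refine intervalIntegral.tendsto_integral_filter_of_dominated_convergence p
      (Filter.Eventually.of_forall fun n => (hψs n).continuous.aestronglyMeasurable)
      (Filter.Eventually.of_forall fun n => ?_) (hpint _ hm (min_le_right _ _)).1 ?_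
    · filter_upwards [hae] with s hs hs'
      rw [Real.norm_of_nonneg (hψpos n s)]
      exact hle n s (hs hs').1 (hs hs').2
    · filter_upwards [hae] with s hs hs'
      refine tendsto_const_nhds.congr' ?_
      filter_upwards [hηlim s (hs hs').1 (hs hs').2] with n hn1
      rw [hn1, one_mul]

lemma exists_eq_polarPt (x₀ x : EuclideanSpace ℝ (Fin 2)) :
    ∃ θ, x = polarPt x₀ ‖x - x₀‖ θ := by
  set z : ℂ := ⟨x 0 - x₀ 0, x 1 - x₀ 1⟩ with hz
  have hn : ‖z‖ = ‖x - x₀‖ := by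
    rw [EuclideanSpace.norm_eq, Complex.norm_def, Complex.normSq_apply, Fin.sum_univ_two]
    simp [hz, sq]
  refine ⟨z.arg, ?_⟩
  ext i
  fin_cases i
  · simp [polarPt, ← hn, Complex.norm_mul_cos_arg, hz]
  · simp [polarPt, ← hn, Complex.norm_mul_sin_arg, hz]

/-- The unit complex number pointing from `x₀` to `x`. -/
noncomputable def angularUnit (x₀ x : EuclideanSpace ℝ (Fin 2)) : ℂ :=
  ((x 0 - x₀ 0 : ℝ) + (x 1 - x₀ 1 : ℝ) * Complex.I) / (‖x - x₀‖ : ℝ)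

lemma angularUnit_polarPt (x₀ : EuclideanSpace ℝ (Fin 2)) {r : ℝ} (hr : 0 < r) (θ : ℝ) :
    angularUnit x₀ (polarPt x₀ r θ) = Complex.exp (θ * Complex.I) := by
  have : (r : ℂ) ≠ 0 := by exact_mod_cast hr.ne'
  rw [angularUnit, norm_polarPt_sub, abs_of_pos hr, Complex.exp_mul_I]
  simp [polarPt]
  field_simp

lemma contDiffAt_angularUnit_zpow {x₀ x : EuclideanSpace ℝ (Fin 2)} (hx : x ≠ x₀) (k : ℤ) :
    ContDiffAt ℝ (⊤ : ℕ∞) (fun x => angularUnit x₀ x ^ k) x := by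
  have hx' : x - x₀ ≠ 0 := sub_ne_zero.2 hx
  have hne : angularUnit x₀ x ≠ 0 := by
    obtain ⟨θ, hθ⟩ := exists_eq_polarPt x₀ x
    rw [hθ, angularUnit_polarPt x₀ (norm_pos_iff.2 hx')]
    exact Complex.exp_ne_zero _
  have hs : ContDiffAt ℝ (⊤ : ℕ∞) (fun x => angularUnit x₀ x) x := by
    have h2 : ContDiffAt ℝ (⊤ : ℕ∞) (fun x => ‖x - x₀‖) x :=
      (contDiffAt_id.sub contDiffAt_const).norm ℝ hx'
    have h3 : ContDiffAt ℝ (⊤ : ℕ∞) (fun x => ((‖x - x₀‖ : ℝ) : ℂ)) x :=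
      Complex.ofRealCLM.contDiff.contDiffAt.comp x h2
    have h4 : ∀ i, ContDiffAt ℝ (⊤ : ℕ∞)
        (fun x : EuclideanSpace ℝ (Fin 2) => ((x i - x₀ i : ℝ) : ℂ)) x := fun i =>
      Complex.ofRealCLM.contDiff.contDiffAt.comp x
        ((contDiffAt_piLp_apply 2).sub contDiffAt_const)
    unfold angularUnit
    simp only [div_eq_mul_inv]
    exact ((h4 0).add ((h4 1).mul contDiffAt_const)).mul
      (h3.inv (by exact_mod_cast (norm_pos_iff.2 hx').ne'))
  rcases k with m | m
  · simpa using hs.pow m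
  · simp only [zpow_negSucc]
    exact (hs.pow (m + 1)).inv (pow_ne_zero _ hne)

section TestFunction

variable {x₀ : EuclideanSpace ℝ (Fin 2)} {φ : ℝ → ℝ} {ε : ℝ}

lemma vanishesNear_radial_mul_angularUnit_zpow (hε : 0 < ε) (h0 : ∀ r ≤ ε, φ r = 0) (k : ℤ) :
    VanishesNear x₀ fun x => φ ‖x - x₀‖ * angularUnit x₀ x ^ k :=
  ⟨ε, hε, fun x hx => by
    rw [mem_ball_iff_norm] at hx
    simp [h0 _ hx.le]⟩

lemma contDiff_radial_mul_angularUnit_zpow (hφ : ContDiff ℝ (⊤ : ℕ∞) φ) (hε : 0 < ε)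
    (h0 : ∀ r ≤ ε, φ r = 0) (k : ℤ) :
    ContDiff ℝ (⊤ : ℕ∞) fun x => (φ ‖x - x₀‖ : ℂ) * angularUnit x₀ x ^ k := by
  refine contDiff_iff_contDiffAt.2 fun x => ?_
  by_cases hx : x = x₀
  · subst hx
    exact (contDiffAt_const (c := (0 : ℂ))).congr_of_eventuallyEq
      (vanishesNear_radial_mul_angularUnit_zpow hε h0 k).eventually
  · refine ContDiffAt.mul ?_ (contDiffAt_angularUnit_zpow hx k)
    exact Complex.ofRealCLM.contDiff.contDiffAt.comp x
      (hφ.contDiffAt.comp x ((contDiffAt_id.sub contDiffAt_const).norm ℝ (sub_ne_zero.2 hx)))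

lemma norm_radial_mul_angularUnit_zpow (hε : 0 < ε) (h0 : ∀ r ≤ ε, φ r = 0) (k : ℤ)
    (x : EuclideanSpace ℝ (Fin 2)) :
    ‖(φ ‖x - x₀‖ : ℂ) * angularUnit x₀ x ^ k‖ ^ 2 = φ ‖x - x₀‖ ^ 2 := by
  by_cases hx : x = x₀
  · simp [hx, h0 0 hε.le]
  · obtain ⟨θ, hθ⟩ := exists_eq_polarPt x₀ x
    have hr := norm_pos_iff.2 (sub_ne_zero.2 hx)
    rw [show angularUnit x₀ x = Complex.exp (θ * Complex.I) by
      rw [← angularUnit_polarPt x₀ hr θ, ← hθ]]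
    rw [norm_mul, norm_zpow, Complex.norm_exp_ofReal_mul_I]
    simp

lemma magGradSq_radial_mul_angularUnit_zpow {φ' : ℝ → ℝ} (hφ : ContDiff ℝ (⊤ : ℕ∞) φ)
    (hφ' : ∀ r, HasDerivAt φ (φ' r) r) (hε : 0 < ε) (h0 : ∀ r ≤ ε, φ r = 0) (k : ℤ) (ν : ℝ)
    {x : EuclideanSpace ℝ (Fin 2)} (hx : x ≠ x₀) :
    magGradSq (AB x₀ ν) (fun x => (φ ‖x - x₀‖ : ℂ) * angularUnit x₀ x ^ k) x =
      φ' ‖x - x₀‖ ^ 2 + (k - ν) ^ 2 * φ ‖x - x₀‖ ^ 2 / ‖x - x₀‖ ^ 2 := by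
  obtain ⟨θ, hθ⟩ := exists_eq_polarPt x₀ x
  have hr := norm_pos_iff.2 (sub_ne_zero.2 hx)
  set r := ‖x - x₀‖ with hrdef
  have hu := (contDiff_radial_mul_angularUnit_zpow (x₀ := x₀) hφ hε h0 k).differentiable (by simp)
  have hval : ∀ s, 0 < s → ∀ t : ℝ, (φ ‖polarPt x₀ s t - x₀‖ : ℂ) *
      angularUnit x₀ (polarPt x₀ s t) ^ k = φ s * Complex.exp (k * (t * Complex.I)) := by
    intro s hs t
    rw [norm_polarPt_sub, abs_of_pos hs, angularUnit_polarPt x₀ hs, Complex.exp_int_mul]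
  have d1 : HasDerivAt (fun s => (φ ‖polarPt x₀ s θ - x₀‖ : ℂ) *
      angularUnit x₀ (polarPt x₀ s θ) ^ k) (φ' r * Complex.exp (k * (θ * Complex.I))) r := by
    refine ((hφ' r).ofReal_comp.mul_const (Complex.exp (k * (θ * Complex.I)))
      ).congr_of_eventuallyEq ?_
    filter_upwards [Ioi_mem_nhds hr] with s hs
    exact hval s hs θ
  have d2 : HasDerivAt (fun t => (φ ‖polarPt x₀ r t - x₀‖ : ℂ) *
      angularUnit x₀ (polarPt x₀ r t) ^ k)
      (φ r * (Complex.exp (k * (θ * Complex.I)) * (k * Complex.I))) θ := by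
    simp only [hval r hr]
    have := ((((hasDerivAt_id θ).ofReal_comp.mul_const Complex.I).const_mul (k : ℂ)).cexp
      ).const_mul (φ r : ℂ)
    simpa using this
  have key := magGradSq_polar x₀ ν
    (fun x => (φ ‖x - x₀‖ : ℂ) * angularUnit x₀ x ^ k) hr θ
  rw [(hasDerivAt_polar_radial x₀ hu r θ).unique d1,
    (hasDerivAt_polar_angular x₀ hu r θ).unique d2, ← hθ] at key
  have hexp : ‖Complex.exp (k * (θ * Complex.I))‖ = 1 := by
    rw [show (k : ℂ) * (θ * Complex.I) = ((k * θ : ℝ) : ℂ) * Complex.I by push_cast; ring,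
      Complex.norm_exp_ofReal_mul_I]
  have e2 : (φ r : ℂ) * (Complex.exp (k * (θ * Complex.I)) * (k * Complex.I)) -
      Complex.I * ν * ((φ ‖x - x₀‖ : ℂ) * angularUnit x₀ x ^ k) =
      ((φ r * (k - ν) : ℝ) : ℂ) * Complex.exp (k * (θ * Complex.I)) * Complex.I := by
    have := hval r hr θ
    rw [← hθ] at this
    rw [this]
    push_cast
    ring
  rw [e2, norm_mul, norm_mul, norm_mul, hexp, Complex.norm_I, Complex.norm_real,
    Complex.norm_real, Real.norm_eq_abs, Real.norm_eq_abs] at key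
  refine mul_left_cancel₀ hr.ne' (key.trans ?_)
  simp only [mul_one, sq_abs]
  field_simp

end TestFunction

lemma setIntegral_sub_const {α : Type*} [MeasurableSpace α] {m : Measure α} {A : Set α}
    (hA : m A ≠ ⊤) {f : α → ℝ} (hf : IntegrableOn f A m) (c : ℝ) :
    ∫ x in A, (f x - c) ∂m = ∫ x in A, f x ∂m - m.real A * c := by
  rw [integral_sub hf (integrableOn_const hA), setIntegral_const, smul_eq_mul]

/-- The bathtub principle: among sets of given measure, superlevel sets maximise the integral. -/
lemma setIntegral_le_of_threshold {α : Type*} [MeasurableSpace α] {m : Measure α} {A B : Set α}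
    (hA : MeasurableSet A) (hB : MeasurableSet B) (hAf : m A ≠ ⊤) (hBf : m B ≠ ⊤)
    (hAB : m.real A = m.real B) {f : α → ℝ} (hfA : IntegrableOn f A m) (hfB : IntegrableOn f B m)
    {c : ℝ} (h1 : ∀ᵐ x ∂m, x ∈ B → c ≤ f x) (h2 : ∀ x ∉ B, f x ≤ c) :
    ∫ x in A, f x ∂m + ∫ x in B \ A, (f x - c) ∂m ≤ ∫ x in B, f x ∂m ∧
      0 ≤ ∫ x in B \ A, (f x - c) ∂m := by
  have iA : IntegrableOn (fun x => f x - c) A m := hfA.sub (integrableOn_const hAf)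
  have iB : IntegrableOn (fun x => f x - c) B m := hfB.sub (integrableOn_const hBf)
  have e1 := integral_inter_add_sdiff hB iA
  have e2 := integral_inter_add_sdiff hA iB
  rw [setIntegral_sub_const hAf hfA] at e1
  rw [setIntegral_sub_const hBf hfB] at e2
  have hneg : ∫ x in A \ B, (f x - c) ∂m ≤ 0 :=
    setIntegral_nonpos (hA.diff hB) fun x hx => sub_nonpos.2 (h2 x hx.2)
  have hpos : 0 ≤ ∫ x in B \ A, (f x - c) ∂m := by
    refine setIntegral_nonneg_of_ae_restrict ?_
    filter_upwards [ae_restrict_of_ae h1, ae_restrict_mem (hB.diff hA)] with x hx hx'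
    exact sub_nonneg.2 (hx hx'.1)
  rw [Set.inter_comm B A] at e2
  rw [hAB] at e1
  exact ⟨by linarith, hpos⟩

section Radial

variable (x₀ : EuclideanSpace ℝ (Fin 2)) (f : ℝ → ℝ) {R : ℝ}

lemma indicator_ball_radial :
    (Metric.ball x₀ R).indicator (fun x => f ‖x - x₀‖) =
      fun x => (Set.Iio R).indicator f ‖x - x₀‖ := by
  ext x
  simp [Set.indicator, dist_eq_norm]

variable {f}

lemma integrableOn_ball_radial (hR : 0 < R)
    (hf : IntervalIntegrable (fun r => r * f r) volume 0 R) :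
    IntegrableOn (fun x => f ‖x - x₀‖) (Metric.ball x₀ R) := by
  have h := integrableOn_fun_norm_addHaar (E := EuclideanSpace ℝ (Fin 2)) volume (f := f) (r := R)
  rw [← integrable_indicator_iff measurableSet_ball, indicator_ball_radial]
  refine Integrable.comp_sub_right (f := fun x => (Set.Iio R).indicator f ‖x‖) ?_ x₀
  have h0 := indicator_ball_radial (R := R) 0 f
  simp only [sub_zero] at h0
  rw [← h0, integrable_indicator_iff measurableSet_ball, h]
  rw [intervalIntegrable_iff_integrableOn_Ioo_of_le hR.le] at hf
  simpa using hf

variable (f)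

lemma setIntegral_ball_radial (hR : 0 < R) :
    ∫ x in Metric.ball x₀ R, f ‖x - x₀‖ =
      2 * volume.real (Metric.ball (0 : EuclideanSpace ℝ (Fin 2)) 1) *
        ∫ r in (0)..R, r * f r := by
  rw [← integral_indicator measurableSet_ball, indicator_ball_radial,
    integral_sub_right_eq_self (fun x => (Set.Iio R).indicator f ‖x‖) x₀,
    integral_fun_norm_addHaar, intervalIntegral.integral_of_le hR.le,
    integral_Ioc_eq_integral_Ioo]
  simp only [finrank_euclideanSpace, Fintype.card_fin, smul_eq_mul, nsmul_eq_mul]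
  have : ∫ y in Set.Ioi (0 : ℝ), y ^ (2 - 1) * (Set.Iio R).indicator f y =
      ∫ r in Set.Ioo 0 R, r * f r := by
    rw [← integral_indicator measurableSet_Ioi, ← integral_indicator measurableSet_Ioo]
    congr 1
    ext y
    by_cases h1 : 0 < y <;> by_cases h2 : y < R <;> simp [h1, h2]
  rw [this]
  push_cast
  ring

end Radial

namespace IsRadialProfile

variable {μ lam R ν : ℝ} {g p : ℝ → ℝ} {k : ℤ}

lemma min_nonneg (h : IsRadialProfile μ lam R g p) (hR : 0 < R) {r : ℝ} (hr : 0 ≤ r) :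
    0 ≤ g (min r R) := by
  rw [← h.map_zero]
  exact h.strictMonoOn.monotoneOn ⟨le_rfl, hR.le⟩ ⟨le_min hr hR.le, min_le_right _ _⟩
    (le_min hr hR.le)

lemma min_le (h : IsRadialProfile μ lam R g p) (hR : 0 < R) {r : ℝ} (hr : 0 ≤ r) :
    g (min r R) ≤ g R :=
  h.strictMonoOn.monotoneOn ⟨le_min hr hR.le, min_le_right _ _⟩ ⟨hR.le, le_rfl⟩ (min_le_right _ _)

lemma integrableOn_radialEnergy_ball (h : IsRadialProfile μ lam R g p) (hR : 0 < R)
    (x₀ : EuclideanSpace ℝ (Fin 2)) :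
    IntegrableOn (fun x => radialEnergy μ R g p ‖x - x₀‖) (Metric.ball x₀ R) :=
  integrableOn_ball_radial x₀ hR (h.integral_radialEnergy hR).1

lemma integrableOn_radialEnergy (h : IsRadialProfile μ lam R g p) (hR : 0 < R)
    (x₀ : EuclideanSpace ℝ (Fin 2)) {D : Set (EuclideanSpace ℝ (Fin 2))} (hD : MeasurableSet D)
    (hDf : volume D ≠ ⊤) : IntegrableOn (fun x => radialEnergy μ R g p ‖x - x₀‖) D := by
  have hm : MeasurableSet (D \ Metric.ball x₀ R) := hD.diff measurableSet_ball
  have h2 : IntegrableOn (fun x => radialEnergy μ R g p ‖x - x₀‖) (D \ Metric.ball x₀ R) := by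
    have hout : ∀ x ∈ D \ Metric.ball x₀ R, R ≤ ‖x - x₀‖ := fun x hx => by
      simpa [dist_eq_norm] using hx.2
    have hmeas : Measurable fun x => μ ^ 2 * g R ^ 2 / ‖x - x₀‖ ^ 2 := by fun_prop
    refine IntegrableOn.congr_fun (f := fun x => μ ^ 2 * g R ^ 2 / ‖x - x₀‖ ^ 2)
      (Measure.integrableOn_of_bounded (M := μ ^ 2 * g R ^ 2 / R ^ 2)
        (ne_top_of_le_ne_top hDf (measure_mono Set.sdiff_subset)) hmeas.aestronglyMeasurable ?_)
      (fun x hx => ?_) hm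
    · filter_upwards [ae_restrict_mem hm] with x hx
      rw [Real.norm_of_nonneg (by positivity)]
      have := hout x hx
      gcongr
    · rw [radialEnergy, if_neg (not_lt.2 (hout x hx)), min_eq_right (hout x hx), zero_add]
  refine ((h.integrableOn_radialEnergy_ball hR x₀).union h2).mono_set ?_
  rw [Set.union_sdiff_self]
  exact Set.subset_union_right

lemma integrableOn_sq (h : IsRadialProfile μ lam R g p) (hR : 0 < R)
    (x₀ : EuclideanSpace ℝ (Fin 2)) {D : Set (EuclideanSpace ℝ (Fin 2))}
    (hDf : volume D ≠ ⊤) : IntegrableOn (fun x => g (min ‖x - x₀‖ R) ^ 2) D := by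
  have hc := h.continuous
  refine Measure.integrableOn_of_bounded (M := g R ^ 2) hDf
    (by fun_prop : Continuous fun x => g (min ‖x - x₀‖ R) ^ 2).aestronglyMeasurable
    (Filter.Eventually.of_forall fun x => ?_)
  rw [Real.norm_of_nonneg (sq_nonneg _)]
  exact pow_le_pow_left₀ (h.min_nonneg hR (norm_nonneg _)) (h.min_le hR (norm_nonneg _)) 2

lemma setIntegral_radialEnergy_ball (h : IsRadialProfile μ lam R g p) (hR : 0 < R)
    (x₀ : EuclideanSpace ℝ (Fin 2)) :
    ∫ x in Metric.ball x₀ R, radialEnergy μ R g p ‖x - x₀‖ =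
      lam * ∫ x in Metric.ball x₀ R, g (min ‖x - x₀‖ R) ^ 2 := by
  have e : ∫ r in (0)..R, r * g (min r R) ^ 2 = ∫ r in (0)..R, r * g r ^ 2 := by
    refine intervalIntegral.integral_congr fun r hr => ?_
    rw [Set.uIcc_of_le hR.le] at hr
    simp only [min_eq_left hr.2]
  rw [setIntegral_ball_radial x₀ _ hR, (h.integral_radialEnergy hR).2,
    setIntegral_ball_radial x₀ (fun r => g (min r R) ^ 2) hR, e]
  ring

lemma setIntegral_sq_ball_pos (h : IsRadialProfile μ lam R g p) (hR : 0 < R)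
    (x₀ : EuclideanSpace ℝ (Fin 2)) :
    0 < ∫ x in Metric.ball x₀ R, g (min ‖x - x₀‖ R) ^ 2 := by
  rw [setIntegral_ball_radial x₀ (fun r => g (min r R) ^ 2) hR]
  have hc := h.continuous
  refine mul_pos (mul_pos two_pos ?_) ?_
  · exact ENNReal.toReal_pos (Metric.measure_ball_pos _ _ one_pos).ne' measure_ball_lt_top.ne
  · refine intervalIntegral.intervalIntegral_pos_of_pos_on
      ((by fun_prop : Continuous fun r => r * g (min r R) ^ 2).intervalIntegrable _ _)
      (fun r hr => ?_) hR
    have := h.pos r hr.1 hr.2.le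
    rw [min_eq_left hr.2.le]
    exact mul_pos hr.1 (pow_pos this 2)

/-- Admissible functions approximating the radial profile with angular momentum `k`. -/
lemma exists_test (h : IsRadialProfile μ lam R g p) (hR : 0 < R) (hk : (k - ν) ^ 2 ≤ μ ^ 2)
    (x₀ : EuclideanSpace ℝ (Fin 2)) {D : Set (EuclideanSpace ℝ (Fin 2))} (hD : MeasurableSet D)
    (hDf : volume D ≠ ⊤) :
    ∃ u : ℕ → EuclideanSpace ℝ (Fin 2) → ℂ, (∀ n, ContDiff ℝ (⊤ : ℕ∞) (u n)) ∧
      (∀ n, VanishesNear x₀ (u n)) ∧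
      (∀ n, ∫ x in D, magGradSq (AB x₀ ν) (u n) x ≤
        ∫ x in D, radialEnergy μ R g p ‖x - x₀‖) ∧
      Filter.Tendsto (fun n => ∫ x in D, ‖u n x‖ ^ 2) Filter.atTop
        (nhds (∫ x in D, g (min ‖x - x₀‖ R) ^ 2)) := by
  obtain ⟨φ, ψ, hφ, hd, h0, hψ, hb, hlim⟩ := h.exists_approx hR
  choose ε hε h0 using h0
  refine ⟨fun n x => φ n ‖x - x₀‖ * angularUnit x₀ x ^ k,
    fun n => contDiff_radial_mul_angularUnit_zpow (hφ n) (hε n) (h0 n) k,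
    fun n => vanishesNear_radial_mul_angularUnit_zpow (hε n) (h0 n) k, fun n => ?_, ?_⟩
  · refine integral_mono_of_nonneg (Filter.Eventually.of_forall fun x => magGradSq_nonneg _ _ x)
      (h.integrableOn_radialEnergy hR x₀ hD hDf) ?_
    filter_upwards [ae_restrict_of_ae (Measure.ae_ne volume x₀)] with x hx
    rw [magGradSq_radial_mul_angularUnit_zpow (hφ n) (hd n) (hε n) (h0 n) k ν hx, radialEnergy]
    have := hb n ‖x - x₀‖ (norm_nonneg _)
    have h3 := this.1
    refine add_le_add (hψ n _) ?_
    gcongr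
    exact this.2
  · simp only [fun n => norm_radial_mul_angularUnit_zpow (x₀ := x₀) (hε n) (h0 n) k]
    refine tendsto_integral_of_dominated_convergence (fun x => g (min ‖x - x₀‖ R) ^ 2)
      (fun n => ?_) (h.integrableOn_sq hR x₀ hDf)
      (fun n => Filter.Eventually.of_forall fun x => ?_)
      (Filter.Eventually.of_forall fun x => (hlim _ (norm_nonneg _)).pow 2)
    · have := (hφ n).continuous
      exact (by fun_prop : Continuous fun x => φ n ‖x - x₀‖ ^ 2).aestronglyMeasurable
    · rw [Real.norm_of_nonneg (sq_nonneg _)]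
      have := hb n ‖x - x₀‖ (norm_nonneg _)
      exact pow_le_pow_left₀ this.1 this.2 2

end IsRadialProfile

lemma rayleigh_nonneg {x₀ : EuclideanSpace ℝ (Fin 2)} {ν : ℝ}
    {D : Set (EuclideanSpace ℝ (Fin 2))} {q : ℝ}
    (hq : ∃ u : EuclideanSpace ℝ (Fin 2) → ℂ, ContDiff ℝ (⊤ : ℕ∞) u ∧ VanishesNear x₀ u ∧
      0 < ∫ x in D, ‖u x‖ ^ 2 ∧
      q = (∫ x in D, magGradSq (AB x₀ ν) u x) / ∫ x in D, ‖u x‖ ^ 2) : 0 ≤ q := by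
  obtain ⟨u, -, -, hpos, rfl⟩ := hq
  exact div_nonneg (integral_nonneg fun x => magGradSq_nonneg _ _ x) hpos.le

lemma lambda1_nonneg (x₀ : EuclideanSpace ℝ (Fin 2)) (ν : ℝ)
    (D : Set (EuclideanSpace ℝ (Fin 2))) : 0 ≤ lambda1 x₀ ν D :=
  Real.sInf_nonneg fun _ hq => rayleigh_nonneg hq

lemma lambda1_mul_le (x₀ : EuclideanSpace ℝ (Fin 2)) (ν : ℝ)
    (D : Set (EuclideanSpace ℝ (Fin 2))) {u : EuclideanSpace ℝ (Fin 2) → ℂ}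
    (hu : ContDiff ℝ (⊤ : ℕ∞) u) (hv : VanishesNear x₀ u) :
    lambda1 x₀ ν D * ∫ x in D, ‖u x‖ ^ 2 ≤ ∫ x in D, magGradSq (AB x₀ ν) u x := by
  have h0 : 0 ≤ ∫ x in D, ‖u x‖ ^ 2 := integral_nonneg fun x => sq_nonneg _
  rcases h0.eq_or_lt with h1 | h1
  · rw [← h1, mul_zero]
    exact integral_nonneg fun x => magGradSq_nonneg _ _ x
  · rw [← le_div_iff₀ h1]
    exact csInf_le ⟨0, fun q hq => rayleigh_nonneg hq⟩ ⟨u, hu, hv, h1, rfl⟩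

namespace IsRadialProfile

variable {μ lam R ν : ℝ} {g p : ℝ → ℝ} {k : ℤ}

lemma lambda1_mul_setIntegral_le (h : IsRadialProfile μ lam R g p) (hR : 0 < R)
    (hk : (k - ν) ^ 2 ≤ μ ^ 2) (x₀ : EuclideanSpace ℝ (Fin 2))
    {D : Set (EuclideanSpace ℝ (Fin 2))} (hD : MeasurableSet D) (hDf : volume D ≠ ⊤) :
    lambda1 x₀ ν D * ∫ x in D, g (min ‖x - x₀‖ R) ^ 2 ≤
      ∫ x in D, radialEnergy μ R g p ‖x - x₀‖ := by
  obtain ⟨u, hu, hv, hle, hlim⟩ := h.exists_test hR hk x₀ hD hDf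
  exact le_of_tendsto (hlim.const_mul _) (Filter.Eventually.of_forall fun n =>
    (lambda1_mul_le x₀ ν D (hu n) (hv n)).trans (hle n))

lemma le_lambda1_ball (h : IsRadialProfile μ lam R g p) (hR : 0 < R)
    (hk : (k - ν) ^ 2 ≤ μ ^ 2) (hμ : ∀ n : ℤ, μ ^ 2 ≤ (ν - n) ^ 2)
    (x₀ : EuclideanSpace ℝ (Fin 2)) : lam ≤ lambda1 x₀ ν (Metric.ball x₀ R) := by
  obtain ⟨u, hu, hv, -, hlim⟩ := h.exists_test hR hk x₀ (D := Metric.ball x₀ R)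
    measurableSet_ball measure_ball_lt_top.ne
  obtain ⟨n, hn⟩ := (hlim.eventually (lt_mem_nhds (h.setIntegral_sq_ball_pos hR x₀))).exists
  refine le_csInf ⟨_, u n, hu n, hv n, hn, rfl⟩ ?_
  rintro q ⟨w, hw, hw0, hpos, rfl⟩
  rw [le_div_iff₀ hpos]
  exact h.le_energy_ball hR hμ x₀ hw hw0

lemma lambda1_le (h : IsRadialProfile μ lam R g p) (hR : 0 < R) (hlam : 0 < lam)
    (hμ1 : μ ^ 2 ≤ 1) (hk : (k - ν) ^ 2 ≤ μ ^ 2) (x₀ : EuclideanSpace ℝ (Fin 2))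
    {Ω : Set (EuclideanSpace ℝ (Fin 2))} (hΩ : MeasurableSet Ω) (hΩf : volume Ω ≠ ⊤)
    (hvol : volume.real Ω = volume.real (Metric.ball x₀ R)) :
    lambda1 x₀ ν Ω ≤ lam ∧ (volume (Metric.ball x₀ R \ Ω) ≠ 0 → lambda1 x₀ ν Ω < lam) := by
  have hB : MeasurableSet (Metric.ball x₀ R) := measurableSet_ball
  have hBf : volume (Metric.ball x₀ R) ≠ ⊤ := measure_ball_lt_top.ne
  have hE := setIntegral_le_of_threshold hΩ hB hΩf hBf hvol
    (h.integrableOn_radialEnergy hR x₀ hΩ hΩf) (h.integrableOn_radialEnergy hR x₀ hB hBf)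
    (c := μ ^ 2 * g R ^ 2 / R ^ 2) (by
      filter_upwards [Measure.ae_ne volume x₀] with x hx hx'
      rw [mem_ball_iff_norm] at hx'
      exact h.le_radialEnergy_of_le hμ1 hlam.le (norm_pos_iff.2 (sub_ne_zero.2 hx)) hx'.le)
    (fun x hx => radialEnergy_le_of_ge hR (by simpa [dist_eq_norm] using hx))
  have hlt : ∀ x ∈ Metric.ball x₀ R, g (min ‖x - x₀‖ R) ^ 2 < g R ^ 2 := by
    intro x hx
    rw [mem_ball_iff_norm] at hx
    refine pow_lt_pow_left₀ ?_ (h.min_nonneg hR (norm_nonneg _)) two_ne_zero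
    rw [min_eq_left hx.le]
    exact h.strictMonoOn ⟨norm_nonneg _, hx.le⟩ ⟨hR.le, le_rfl⟩ hx
  have iB := (h.integrableOn_sq hR x₀ hBf).neg
  have hG := setIntegral_le_of_threshold hΩ hB hΩf hBf hvol
    (h.integrableOn_sq hR x₀ hΩf).neg iB
    (c := -g R ^ 2) (Filter.Eventually.of_forall fun x hx => neg_le_neg (hlt x hx).le)
    (fun x hx => by
      rw [mem_ball_iff_norm, not_lt] at hx
      simp [min_eq_right hx])
  simp only [Pi.neg_apply, integral_neg] at hG
  have hpos := h.setIntegral_sq_ball_pos hR x₀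
  have hmain := (h.lambda1_mul_setIntegral_le hR hk x₀ hΩ hΩf).trans
    ((le_add_of_nonneg_right hE.2).trans hE.1)
  rw [h.setIntegral_radialEnergy_ball hR x₀] at hmain
  have hGle : ∫ x in Metric.ball x₀ R, g (min ‖x - x₀‖ R) ^ 2 ≤
      ∫ x in Ω, g (min ‖x - x₀‖ R) ^ 2 := by linarith [hG.1, hG.2]
  refine ⟨le_of_mul_le_mul_right (hmain.trans (mul_le_mul_of_nonneg_left hGle hlam.le))
    (hpos.trans_le hGle), fun hne => ?_⟩
  have hstrict : 0 < ∫ x in Metric.ball x₀ R \ Ω, (-g (min ‖x - x₀‖ R) ^ 2 - -g R ^ 2) := by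
    have hi : IntegrableOn (fun x => -g (min ‖x - x₀‖ R) ^ 2 - -g R ^ 2)
        (Metric.ball x₀ R \ Ω) :=
      (iB.sub (integrableOn_const hBf)).mono_set Set.sdiff_subset
    rw [setIntegral_pos_iff_support_of_nonneg_ae _ hi]
    · rw [Set.inter_eq_self_of_subset_right]
      · exact pos_iff_ne_zero.2 hne
      · intro x hx
        have := hlt x hx.1
        rw [Function.mem_support]
        linarith
    · filter_upwards [ae_restrict_mem (hB.diff hΩ)] with x hx
      have := hlt x hx.1
      simp only [Pi.zero_apply]
      linarith
  refine lt_of_mul_lt_mul_right (hmain.trans_lt (mul_lt_mul_of_pos_left (by linarith [hG.1]) hlam))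
    (hpos.le.trans hGle)

end IsRadialProfile

/-- An open set with smooth boundary that fills a disk of the same area up to a null set is that
disk. -/
lemma HasSmoothBoundary.eq_ball {Ω : Set (EuclideanSpace ℝ (Fin 2))} (hopen : IsOpen Ω)
    (hsmooth : HasSmoothBoundary Ω) {x₀ : EuclideanSpace ℝ (Fin 2)} {R : ℝ} (hR : 0 < R)
    (hvol : volume Ω = volume (Metric.ball x₀ R))
    (hnull : volume (Metric.ball x₀ R \ Ω) = 0) : Ω = Metric.ball x₀ R := by
  have hnull' : volume (Ω \ Metric.ball x₀ R) = 0 := by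
    have e1 := measure_inter_add_sdiff (μ := volume) Ω
      (measurableSet_ball (x := x₀) (ε := R))
    have e2 := measure_inter_add_sdiff (μ := volume) (Metric.ball x₀ R) hopen.measurableSet
    rw [hnull, add_zero, Set.inter_comm] at e2
    rw [e2, hvol] at e1
    exact (ENNReal.add_right_inj measure_ball_lt_top.ne).1 (e1.trans (add_zero _).symm)
  refine Set.Subset.antisymm ?_ fun x hx => ?_
  · rw [← interior_closedBall x₀ hR.ne']
    refine interior_maximal (Set.sdiff_eq_empty.1 ?_) hopen
    exact (hopen.sdiff Metric.isClosed_closedBall).eq_empty_of_measure_zero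
      (measure_mono_null (Set.sdiff_subset_sdiff_right Metric.ball_subset_closedBall) hnull')
  · by_contra hxΩ
    have hempty : ∀ U : Set (EuclideanSpace ℝ (Fin 2)), IsOpen U → x ∈ U → (U ∩ Ω).Nonempty := by
      intro U hU hxU
      by_contra hne
      rw [Set.not_nonempty_iff_eq_empty] at hne
      have hsub : U ∩ Metric.ball x₀ R ⊆ Metric.ball x₀ R \ Ω := fun y hy =>
        ⟨hy.2, fun hyΩ => hne.subset ⟨hy.1, hyΩ⟩⟩
      have : U ∩ Metric.ball x₀ R = ∅ :=
        (hU.inter Metric.isOpen_ball).eq_empty_of_measure_zero (measure_mono_null hsub hnull)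
      exact Set.eq_empty_iff_forall_notMem.1 this x ⟨hxU, hx⟩
    have hfr : x ∈ frontier Ω := by
      rw [frontier, hopen.interior_eq]
      exact ⟨mem_closure_iff.2 hempty, hxΩ⟩
    obtain ⟨f, ε, hε, hf, hne, hiff⟩ := hsmooth x hfr
    have hfx : 0 ≤ f x := by
      rw [hiff x (Metric.mem_ball_self hε), not_lt] at hxΩ
      exact hxΩ
    refine hne (IsLocalMax.fderiv_eq_zero ?_)
    filter_upwards [Metric.ball_mem_nhds x hε, Metric.isOpen_ball.mem_nhds hx] with y hy hyB
    by_contra hlt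
    set V := {z | f x < f z} ∩ Metric.ball x ε ∩ Metric.ball x₀ R
    have hsub : V ⊆ Metric.ball x₀ R \ Ω := fun z hz => ⟨hz.2, fun hzΩ =>
      absurd ((hiff z hz.1.2).1 hzΩ) (not_lt.2 (hfx.trans (le_of_lt hz.1.1)))⟩
    have hV : V = ∅ :=
      (((isOpen_lt continuous_const hf.continuous).inter Metric.isOpen_ball).inter
        Metric.isOpen_ball).eq_empty_of_measure_zero (measure_mono_null hsub hnull)
    exact Set.eq_empty_iff_forall_notMem.1 hV y ⟨⟨not_le.1 hlt, hy⟩, hyB⟩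

/-- Szegő–Weinberger type reverse Faber–Krahn inequality for the first magnetic Neumann
eigenvalue of the Aharonov–Bohm operator on planar domains. -/
theorem neumann_isoperimetric (Ω : Set (EuclideanSpace ℝ (Fin 2)))
    (hopen : IsOpen Ω) (hbdd : Bornology.IsBounded Ω) (hsmooth : HasSmoothBoundary Ω)
    (x₀ : EuclideanSpace ℝ (Fin 2)) (ν : ℝ) (R : ℝ) (hR : 0 < R)
    (hvol : (volume Ω).toReal = Real.pi * R ^ 2) :
    lambda1 x₀ ν Ω ≤ lambda1 x₀ ν (Metric.ball x₀ R) ∧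
    ((∀ k : ℤ, (k : ℝ) ≠ ν) → lambda1 x₀ ν Ω = lambda1 x₀ ν (Metric.ball x₀ R) →
      Ω = Metric.ball x₀ R) := by
  have hm := hopen.measurableSet
  have hf : volume Ω ≠ ⊤ := hbdd.measure_lt_top.ne
  have hvol' : volume.real Ω = volume.real (Metric.ball x₀ R) := by
    rw [measureReal_def, measureReal_def, hvol, EuclideanSpace.volume_ball_fin_two,
      ENNReal.toReal_mul, ENNReal.toReal_pow, ENNReal.toReal_ofReal hR.le,
      ENNReal.toReal_ofReal Real.pi_pos.le, mul_comm]
  have hμ : ∀ n : ℤ, |ν - round ν| ^ 2 ≤ (ν - n) ^ 2 := fun n => by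
    rw [← sq_abs (ν - n)]
    exact pow_le_pow_left₀ (abs_nonneg _) (round_le ν n) 2
  have hk : ((round ν : ℤ) - ν) ^ 2 ≤ |ν - round ν| ^ 2 := by
    rw [sq_abs]
    exact le_of_eq (by ring)
  rcases (abs_nonneg (ν - round ν)).eq_or_lt with h0 | hpos
  · have hν : ((round ν : ℤ) : ℝ) = ν := by linarith [abs_eq_zero.1 h0.symm]
    refine ⟨le_trans ?_ (lambda1_nonneg x₀ ν _), fun h => absurd hν (h _)⟩
    have hlim : Filter.Tendsto (fun μ : ℝ => 4 * μ / R ^ 2) (nhdsWithin 0 (Set.Ioi 0))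
        (nhds 0) := by
      have : Continuous fun μ : ℝ => 4 * μ / R ^ 2 := by fun_prop
      simpa using this.continuousWithinAt.tendsto (x := (0 : ℝ)) (s := Set.Ioi 0)
    refine ge_of_tendsto hlim ?_
    filter_upwards [Ioo_mem_nhdsGT (show (0 : ℝ) < 1 / 2 by norm_num)] with μ hμ'
    obtain ⟨lam, g, p, hlam, hle, h⟩ := exists_isRadialProfile hμ'.1 hμ'.2.le hR
    refine ((h.lambda1_le hR hlam (by nlinarith [hμ'.1, hμ'.2]) (k := round ν) ?_ x₀ hm hf
      hvol').1).trans hle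
    rw [hν, sub_self, sq, mul_zero]
    positivity
  · obtain ⟨lam, g, p, hlam, -, h⟩ := exists_isRadialProfile hpos (abs_sub_round ν) hR
    have hle := h.le_lambda1_ball hR hk hμ x₀
    have hΩ := h.lambda1_le hR hlam
      (pow_le_one₀ hpos.le ((abs_sub_round ν).trans (by norm_num))) hk x₀ hm hf hvol'
    refine ⟨hΩ.1.trans hle, fun _ heq => hsmooth.eq_ball hopen hR ?_ ?_⟩
    · exact (ENNReal.toReal_eq_toReal_iff' hf measure_ball_lt_top.ne).1 hvol'
    · by_contra hne
      linarith [hΩ.2 hne]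
end

section
/- Let x₀ ∈ ℝ², R > 0 and ν ∈ ℝ. Then the first magnetic Steklov eigenvalue of the disk B(x₀,R) with the Aharonov–Bohm potential of pole x₀ and flux ν equals d(ν,ℤ)/R, that is, σ₁(B(x₀,R), A_{x₀,ν}) = d(ν,ℤ)/R. -/
open MeasureTheory

open Real Set Filter Topology

theorem distInt_eq_abs_sub_round (ν : ℝ) : distInt ν = |ν - round ν| := by
  apply le_antisymm
  · exact ciInf_le ⟨0, by rintro _ ⟨k, rfl⟩; exact abs_nonneg _⟩ (round ν)
  · exact le_ciInf fun k => round_le ν k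

theorem distInt_nonneg (ν : ℝ) : 0 ≤ distInt ν :=
  distInt_eq_abs_sub_round ν ▸ abs_nonneg _

theorem fourierCoeffOn_magneticDeriv {U U' : ℝ → ℂ} (hU : ∀ θ, HasDerivAt U (U' θ) θ)
    (hU' : Continuous U') (hper : U (-π) = U π) (hpi : -π < π) (ν : ℝ) (n : ℤ) :
    fourierCoeffOn hpi (fun θ => U' θ - Complex.I * ν * U θ) n =
      Complex.I * (n - ν) * fourierCoeffOn hpi U n := by
  have hUc : Continuous U := continuous_iff_continuousAt.2 fun θ => (hU θ).continuousAt
  have hf : ∀ x : ℝ, (fourier (-n) (x : AddCircle (π - -π)) : ℂ) =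
      Complex.exp (-(Complex.I * n * x)) := by
    intro x
    rw [fourier_coe_apply]
    congr 1
    have : (π : ℂ) ≠ 0 := by exact_mod_cast pi_ne_zero
    push_cast
    field_simp
    ring
  have hE : ∀ x : ℝ, HasDerivAt (fun x : ℝ => Complex.exp (-(Complex.I * n * x)))
      (Complex.exp (-(Complex.I * n * x)) * (-(Complex.I * n))) x := by
    intro x
    have h1 : HasDerivAt (fun x : ℂ => Complex.exp (-(Complex.I * n * x)))
      (Complex.exp (-(Complex.I * n * x)) * (-(Complex.I * n))) (x : ℂ) := by
      have := (((hasDerivAt_id (x : ℂ)).const_mul (Complex.I * n)).neg).cexp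
      simpa using this
    exact h1.comp_ofReal
  have hparts : ∫ x in (-π)..π, (Complex.exp (-(Complex.I * n * x)) * (-(Complex.I * n)) * U x
      + Complex.exp (-(Complex.I * n * x)) * U' x) = 0 := by
    rw [intervalIntegral.integral_eq_sub_of_hasDerivAt (fun x _ => (hE x).mul (hU x))
      (Continuous.intervalIntegrable (by fun_prop) _ _)]
    have : Complex.exp (-(Complex.I * n * (π : ℝ))) = Complex.exp (-(Complex.I * n * (-π : ℝ))) := by
      rw [Complex.exp_eq_exp_iff_exists_int]
      exact ⟨-n, by push_cast; ring⟩
    simp only [Pi.mul_apply, this, hper, sub_self]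
  rw [fourierCoeffOn_eq_integral, fourierCoeffOn_eq_integral, mul_smul_comm]
  congr 1
  simp only [hf, smul_eq_mul]
  rw [← intervalIntegral.integral_const_mul, ← sub_eq_zero, ← intervalIntegral.integral_sub
    (Continuous.intervalIntegrable (by fun_prop) _ _)
    (Continuous.intervalIntegrable (by fun_prop) _ _), ← hparts]
  congr 1
  ext x
  ring

theorem distInt_sq_mul_integral_le {U U' : ℝ → ℂ} (hU : ∀ θ, HasDerivAt U (U' θ) θ)
    (hU' : Continuous U') (hper : U (-π) = U π) (ν : ℝ) :
    distInt ν ^ 2 * ∫ θ in (-π)..π, ‖U θ‖ ^ 2 ≤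
      ∫ θ in (-π)..π, ‖U' θ - Complex.I * ν * U θ‖ ^ 2 := by
  have hUc : Continuous U := continuous_iff_continuousAt.2 fun θ => (hU θ).continuousAt
  have hpi : -π < π := by linarith [pi_pos]
  have hL2 : ∀ f : ℝ → ℂ, Continuous f → MemLp f 2 (volume.restrict (Ioc (-π) π)) := by
    intro f hf
    rw [memLp_two_iff_integrable_sq_norm hf.aestronglyMeasurable]
    exact (Continuous.integrableOn_Icc (by fun_prop)).mono_set Ioc_subset_Icc_self
  have h1 := hasSum_sq_fourierCoeffOn hpi (hL2 U hUc)
  have h2 := hasSum_sq_fourierCoeffOn hpi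
    (hL2 (fun θ => U' θ - Complex.I * ν * U θ) (by fun_prop))
  have h3 := hasSum_le (fun n => ?_) (h1.mul_left (distInt ν ^ 2)) h2
  · have h4 : (0 : ℝ) < (π - -π)⁻¹ := by rw [inv_pos]; linarith
    simp only [smul_eq_mul] at h3
    rw [mul_left_comm] at h3
    exact le_of_mul_le_mul_left h3 h4
  · rw [fourierCoeffOn_magneticDeriv hU hU' hper hpi, norm_mul, mul_pow]
    gcongr
    · exact distInt_nonneg ν
    · have : ‖Complex.I * ((n : ℂ) - ν)‖ = |ν - n| := by
        rw [norm_mul, Complex.norm_I, one_mul, norm_sub_rev, ← Complex.ofReal_intCast,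
          ← Complex.ofReal_sub, Complex.norm_real, norm_eq_abs]
      rw [this]
      exact ciInf_le ⟨0, by rintro _ ⟨k, rfl⟩; exact abs_nonneg _⟩ n

theorem volume_arc_le (R : ℝ) (hR : 0 ≤ R) (S : Set ℝ) :
    (μH[1] : Measure ℂ) (circleMap 0 R '' S) ≤ ENNReal.ofReal R * volume S := by
  have := (lipschitzWith_circleMap 0 R).hausdorffMeasure_image_le zero_le_one S
  rwa [hausdorffMeasure_real, ENNReal.rpow_one, Real.nnabs_of_nonneg hR] at this

theorem le_hausdorffMeasure_arc (R a δ : ℝ) (hR : 0 < R) (hδ : 0 < δ) (hδ' : δ ≤ π / 2) :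
    ENNReal.ofReal (2 * R * sin δ) ≤
      (μH[1] : Measure ℂ) (circleMap 0 R '' Ioo (a - δ) (a + δ)) := by
  let p : ℂ → ℝ := fun z => (z * Complex.exp (-(a * Complex.I))).im
  have hp : LipschitzWith 1 p := by
    refine LipschitzWith.of_dist_le_mul fun z w => ?_
    simp only [p, NNReal.coe_one, one_mul, dist_eq_norm]
    rw [← Complex.sub_im, ← sub_mul]
    refine (Complex.abs_im_le_norm _).trans_eq ?_
    rw [norm_mul, ← neg_mul, ← Complex.ofReal_neg, Complex.norm_exp_ofReal_mul_I, mul_one]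
  have h := hp.hausdorffMeasure_image_le zero_le_one (circleMap 0 R '' Ioo (a - δ) (a + δ))
  rw [hausdorffMeasure_real, ENNReal.rpow_one, ENNReal.coe_one, one_mul] at h
  refine le_trans ?_ h
  have hpc : ∀ t : ℝ, p (circleMap 0 R t) = R * sin (t - a) := by
    intro t
    simp only [p, circleMap, zero_add]
    rw [mul_assoc, ← Complex.exp_add, ← neg_mul, ← add_mul, ← Complex.ofReal_neg,
      ← Complex.ofReal_add, Complex.im_ofReal_mul, Complex.exp_ofReal_mul_I_im, sub_eq_add_neg]
  have hsub : Ioo (-(R * sin δ)) (R * sin δ) ⊆ p '' (circleMap 0 R '' Ioo (a - δ) (a + δ)) := by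
    intro y hy
    have hs1 : -1 ≤ y / R := by
      rw [le_div_iff₀ hR]; nlinarith [hy.1, sin_le_one δ]
    have hs2 : y / R ≤ 1 := by
      rw [div_le_iff₀ hR]; nlinarith [hy.2, sin_le_one δ]
    have hy1 : y / R < sin δ := by rw [div_lt_iff₀ hR]; linarith [hy.2]
    have hy2 : sin (-δ) < y / R := by rw [sin_neg, lt_div_iff₀ hR]; linarith [hy.1]
    refine ⟨_, ⟨a + arcsin (y / R), ⟨?_, ?_⟩, rfl⟩, ?_⟩
    · have := (lt_arcsin_iff_sin_lt ⟨by linarith, by linarith⟩ ⟨hs1, hs2⟩).2 hy2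
      linarith
    · have := (arcsin_lt_iff_lt_sin ⟨hs1, hs2⟩ ⟨by linarith, by linarith⟩).2 hy1
      linarith
    · rw [hpc, add_sub_cancel_left, sin_arcsin hs1 hs2]
      field_simp
  refine le_trans ?_ (measure_mono hsub)
  rw [Real.volume_Ioo]
  apply ENNReal.ofReal_le_ofReal
  linarith

theorem le_hausdorffMeasure_sphere (R : ℝ) (hR : 0 < R) (n : ℕ) (hn : 2 ≤ n) :
    ENNReal.ofReal (2 * R * (n * sin (π / n))) ≤ (μH[1] : Measure ℂ) (Metric.sphere 0 R) := by
  have hn0 : (0 : ℝ) < n := by positivity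
  have hn2 : (2 : ℝ) ≤ n := by exact_mod_cast hn
  have hδ : 0 < π / n := by positivity
  have hδ' : π / n ≤ π / 2 := by gcongr
  let I : ℕ → Set ℝ := fun k =>
    Ioo ((-π + (2 * k + 1) * (π / n)) - π / n) ((-π + (2 * k + 1) * (π / n)) + π / n)
  have hI : ∀ k < n, I k ⊆ Ioc (-π) π := by
    intro k hk t ht
    have hk' : (k : ℝ) + 1 ≤ n := by exact_mod_cast hk
    have h1 : ((k : ℝ) + 1) * (π / n) ≤ n * (π / n) := by gcongr
    have h2 : (n : ℝ) * (π / n) = π := by field_simp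
    have h3 : 0 ≤ (k : ℝ) * (π / n) := by positivity
    constructor <;> nlinarith [ht.1, ht.2]
  have hdisj : ∀ k l, k < l → Disjoint (I k) (I l) := by
    intro k l hkl
    rw [Set.disjoint_left]
    intro t h1 h2
    have : (k : ℝ) + 1 ≤ l := by exact_mod_cast hkl
    nlinarith [h1.2, h2.1]
  have hinj : InjOn (circleMap 0 R) (Ioc (-π) π) := by
    rw [← uIoc_of_le (by linarith [pi_pos] : -π ≤ π)]
    apply injOn_circleMap_of_abs_sub_le hR.ne'
    rw [show -π - π = -(2 * π) by ring, abs_neg, abs_of_pos two_pi_pos]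
  have hmeas : ∀ k ∈ Finset.range n, MeasurableSet (circleMap 0 R '' I k) := fun k hk =>
    measurableSet_Ioo.image_of_continuousOn_injOn (continuous_circleMap 0 R).continuousOn
      (hinj.mono (hI k (Finset.mem_range.1 hk)))
  calc ENNReal.ofReal (2 * R * (n * sin (π / n)))
      = ∑ k ∈ Finset.range n, ENNReal.ofReal (2 * R * sin (π / n)) := by
        rw [Finset.sum_const, Finset.card_range, nsmul_eq_mul, ← ENNReal.ofReal_natCast,
          ← ENNReal.ofReal_mul (by positivity)]
        congr 1; ring
    _ ≤ ∑ k ∈ Finset.range n, (μH[1] : Measure ℂ) (circleMap 0 R '' I k) :=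
        Finset.sum_le_sum fun k _ => le_hausdorffMeasure_arc R _ _ hR hδ hδ'
    _ = (μH[1] : Measure ℂ) (⋃ k ∈ Finset.range n, circleMap 0 R '' I k) := by
        refine (measure_biUnion_finset ?_ hmeas).symm
        intro k hk l hl hkl
        have hk := Finset.mem_range.1 hk
        have hl := Finset.mem_range.1 hl
        have hd : Disjoint (I k) (I l) := by
          rcases lt_or_gt_of_ne hkl with h | h
          · exact hdisj k l h
          · exact (hdisj l k h).symm
        rw [Function.onFun, Set.disjoint_iff_inter_eq_empty,
          ← hinj.image_inter (hI k hk) (hI l hl), hd.inter_eq, image_empty]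
    _ ≤ _ := by
        refine measure_mono (iUnion₂_subset fun k _ => ?_)
        rintro _ ⟨t, _, rfl⟩
        exact circleMap_mem_sphere 0 hR.le t

theorem tendsto_natCast_mul_sin_pi_div :
    Tendsto (fun n : ℕ => (n : ℝ) * sin (π / n)) atTop (𝓝 π) := by
  have h1 : Tendsto (fun n : ℕ => π / (n : ℝ)) atTop (𝓝 0) :=
    tendsto_const_div_atTop_nhds_zero_nat π
  have h2 : Tendsto (fun n : ℕ => π * sinc (π / n)) atTop (𝓝 (π * sinc 0)) :=
    ((continuous_sinc.tendsto 0).comp h1).const_mul π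
  rw [sinc_zero, mul_one] at h2
  refine h2.congr' ?_
  filter_upwards [eventually_gt_atTop 0] with n hn
  have hn0 : (n : ℝ) ≠ 0 := by positivity
  rw [sinc_of_ne_zero (by positivity)]
  field_simp

theorem hausdorffMeasure_restrict_sphere (R : ℝ) (hR : 0 < R) :
    (μH[1] : Measure ℂ).restrict (Metric.sphere 0 R) =
      ENNReal.ofReal R • (volume.restrict (Ioc (-π) π)).map (circleMap 0 R) := by
  have himg : circleMap 0 R '' Ioc (-π) π = Metric.sphere 0 R := by
    have := (periodic_circleMap 0 R).image_Ioc two_pi_pos (-π)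
    rw [show -π + 2 * π = π by ring] at this
    rw [this, range_circleMap, abs_of_pos hR]
  have hcm : Measurable (circleMap 0 R) := (continuous_circleMap 0 R).measurable
  have hle : (μH[1] : Measure ℂ).restrict (Metric.sphere 0 R) ≤
      ENNReal.ofReal R • (volume.restrict (Ioc (-π) π)).map (circleMap 0 R) := by
    refine Measure.le_iff.2 fun S hS => ?_
    rw [Measure.restrict_apply hS, Measure.smul_apply, smul_eq_mul, Measure.map_apply hcm hS,
      Measure.restrict_apply (hcm hS), ← himg, inter_comm, ← image_inter_preimage, inter_comm]
    exact volume_arc_le R hR.le _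
  have : IsFiniteMeasure
      (ENNReal.ofReal R • (volume.restrict (Ioc (-π) π)).map (circleMap 0 R)) :=
    Measure.smul_finite _ ENNReal.ofReal_ne_top
  have : IsFiniteMeasure ((μH[1] : Measure ℂ).restrict (Metric.sphere 0 R)) :=
    isFiniteMeasure_of_le _ hle
  refine Measure.eq_of_le_of_measure_univ_eq hle (le_antisymm (hle _) ?_)
  rw [Measure.smul_apply, smul_eq_mul, Measure.map_apply hcm .univ, preimage_univ,
    Measure.restrict_apply_univ, Measure.restrict_apply_univ, Real.volume_Ioc,
    ← ENNReal.ofReal_mul hR.le]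
  have hlim := ENNReal.tendsto_ofReal (tendsto_natCast_mul_sin_pi_div.const_mul (2 * R))
  rw [show R * (π - -π) = 2 * R * π by ring]
  refine le_of_tendsto hlim ?_
  filter_upwards [eventually_ge_atTop 2] with n hn
  exact le_hausdorffMeasure_sphere R hR n hn

theorem setIntegral_sphere_eq (R : ℝ) (hR : 0 < R) {f : ℂ → ℝ} (hf : Continuous f) :
    ∫ z in Metric.sphere 0 R, f z ∂μH[1] = R * ∫ θ in (-π)..π, f (circleMap 0 R θ) := by
  rw [hausdorffMeasure_restrict_sphere R hR, integral_smul_measure, integral_map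
    (continuous_circleMap 0 R).aemeasurable hf.aestronglyMeasurable,
    intervalIntegral.integral_of_le (by linarith [pi_pos]), ENNReal.toReal_ofReal hR.le,
    smul_eq_mul]

theorem setIntegral_ball_eq_polar {f : ℂ → ℝ} (hf : Continuous f) {R : ℝ} (hR : 0 ≤ R) :
    ∫ z in Metric.ball 0 R, f z = ∫ r in 0..R, ∫ θ in (-π)..π, r * f (circleMap 0 r θ) := by
  have hcm : ∀ p : ℝ × ℝ, Complex.polarCoord.symm p = circleMap 0 p.1 p.2 := by
    intro p
    rw [Complex.polarCoord_symm_apply, circleMap, zero_add, Complex.exp_mul_I]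
    simp
  have hint : IntegrableOn (fun p : ℝ × ℝ => p.1 * f (circleMap 0 p.1 p.2))
      (Ioc 0 R ×ˢ Ioc (-π) π) (volume.prod volume) := by
    have hc : Continuous (fun p : ℝ × ℝ => p.1 * f (circleMap 0 p.1 p.2)) := by
      unfold circleMap; fun_prop
    exact (hc.continuousOn.integrableOn_compact (isCompact_Icc.prod isCompact_Icc)).mono_set
      (prod_mono Ioc_subset_Icc_self Ioc_subset_Icc_self)
  have hset : ((Ioo 0 R ×ˢ Ioo (-π) π : Set (ℝ × ℝ))) =ᵐ[volume.prod volume]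
      (Ioc 0 R ×ˢ Ioc (-π) π : Set (ℝ × ℝ)) :=
    Measure.set_prod_ae_eq Ioo_ae_eq_Ioc Ioo_ae_eq_Ioc
  rw [← integral_indicator measurableSet_ball, ← Complex.integral_comp_polarCoord_symm]
  have h1 : ∀ p ∈ polarCoord.target,
      p.1 • (Metric.ball 0 R).indicator f (Complex.polarCoord.symm p) =
        (Ioo 0 R ×ˢ Ioo (-π) π).indicator
          (fun p : ℝ × ℝ => p.1 * f (circleMap 0 p.1 p.2)) p := by
    intro p hp
    have hp1 : 0 < p.1 := hp.1
    have hp2 : p.2 ∈ Ioo (-π) π := hp.2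
    have hmem : Complex.polarCoord.symm p ∈ Metric.ball (0 : ℂ) R ↔ p ∈ Ioo 0 R ×ˢ Ioo (-π) π := by
      rw [mem_ball_zero_iff, Complex.norm_polarCoord_symm, abs_of_pos hp1]
      exact ⟨fun h => ⟨⟨hp1, h⟩, hp2⟩, fun h => h.1.2⟩
    by_cases h : p ∈ Ioo 0 R ×ˢ Ioo (-π) π
    · rw [indicator_of_mem h, indicator_of_mem (hmem.2 h), hcm, smul_eq_mul]
    · rw [indicator_of_notMem h, indicator_of_notMem (mt hmem.1 h), smul_zero]
  rw [setIntegral_congr_fun polarCoord.open_target.measurableSet h1,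
    setIntegral_indicator (measurableSet_Ioo.prod measurableSet_Ioo)]
  have h2 : polarCoord.target ∩ Ioo 0 R ×ˢ Ioo (-π) π = Ioo 0 R ×ˢ Ioo (-π) π :=
    inter_eq_right.2 fun p hp => ⟨hp.1.1, hp.2⟩
  rw [h2, Measure.volume_eq_prod, setIntegral_congr_set hset, setIntegral_prod _ hint,
    intervalIntegral.integral_of_le hR]
  simp_rw [intervalIntegral.integral_of_le (by linarith [pi_pos] : -π ≤ π)]

/-- The isometric chart `z ↦ x₀ + (re z, im z)` of the Euclidean plane. -/
noncomputable def planeChart (x₀ : EuclideanSpace ℝ (Fin 2)) : ℂ ≃ᵢ EuclideanSpace ℝ (Fin 2) :=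
  Complex.orthonormalBasisOneI.repr.toIsometryEquiv.trans (IsometryEquiv.addLeft x₀)

theorem planeChart_apply (x₀ : EuclideanSpace ℝ (Fin 2)) (z : ℂ) :
    planeChart x₀ z = x₀ + Complex.orthonormalBasisOneI.repr z := rfl

theorem planeChart_zero (x₀ : EuclideanSpace ℝ (Fin 2)) : planeChart x₀ 0 = x₀ := by
  simp [planeChart_apply]

theorem measurePreserving_planeChart (x₀ : EuclideanSpace ℝ (Fin 2)) :
    MeasurePreserving (planeChart x₀) :=
  (measurePreserving_add_left volume x₀).comp
    Complex.orthonormalBasisOneI.repr.measurePreserving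

theorem measurableEmbedding_planeChart (x₀ : EuclideanSpace ℝ (Fin 2)) :
    MeasurableEmbedding (planeChart x₀) :=
  (planeChart x₀).toHomeomorph.measurableEmbedding

theorem setIntegral_ball_planeChart (x₀ : EuclideanSpace ℝ (Fin 2)) (R : ℝ)
    (f : EuclideanSpace ℝ (Fin 2) → ℝ) :
    ∫ x in Metric.ball x₀ R, f x = ∫ z in Metric.ball 0 R, f (planeChart x₀ z) := by
  rw [← (measurePreserving_planeChart x₀).setIntegral_preimage_emb
    (measurableEmbedding_planeChart x₀), (planeChart x₀).preimage_ball,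
    (planeChart x₀).symm_apply_eq.2 (planeChart_zero x₀).symm]

theorem setIntegral_sphere_planeChart (x₀ : EuclideanSpace ℝ (Fin 2)) (R : ℝ)
    (f : EuclideanSpace ℝ (Fin 2) → ℝ) :
    ∫ x in Metric.sphere x₀ R, f x ∂μH[1] =
      ∫ z in Metric.sphere 0 R, f (planeChart x₀ z) ∂μH[1] := by
  rw [← ((planeChart x₀).measurePreserving_hausdorffMeasure 1).setIntegral_preimage_emb
    (measurableEmbedding_planeChart x₀), (planeChart x₀).preimage_sphere,
    (planeChart x₀).symm_apply_eq.2 (planeChart_zero x₀).symm]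

theorem contDiff_planeChart (x₀ : EuclideanSpace ℝ (Fin 2)) :
    ContDiff ℝ (⊤ : ℕ∞) (planeChart x₀) :=
  contDiff_const.add Complex.orthonormalBasisOneI.repr.toContinuousLinearEquiv.contDiff

theorem hasFDerivAt_comp_planeChart (x₀ : EuclideanSpace ℝ (Fin 2))
    {u : EuclideanSpace ℝ (Fin 2) → ℂ} (hu : Differentiable ℝ u) (z : ℂ) :
    HasFDerivAt (fun z => u (planeChart x₀ z)) ((fderiv ℝ u (planeChart x₀ z)).comp
      (Complex.orthonormalBasisOneI.repr.toContinuousLinearEquiv : ℂ →L[ℝ] _)) z := by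
  refine (hu _).hasFDerivAt.comp z ?_
  exact (Complex.orthonormalBasisOneI.repr.toContinuousLinearEquiv :
    ℂ →L[ℝ] _).hasFDerivAt.const_add x₀

theorem norm_rotation_sq_add (p q : ℂ) (θ : ℝ) :
    ‖cos θ * p + sin θ * q‖ ^ 2 + ‖-sin θ * p + cos θ * q‖ ^ 2 = ‖p‖ ^ 2 + ‖q‖ ^ 2 := by
  simp only [Complex.sq_norm, Complex.normSq_apply, Complex.add_re, Complex.add_im, Complex.mul_re,
    Complex.mul_im, Complex.neg_re, Complex.neg_im, Complex.ofReal_re, Complex.ofReal_im]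
  linear_combination (p.re ^ 2 + p.im ^ 2 + q.re ^ 2 + q.im ^ 2) * sin_sq_add_cos_sq θ

theorem magGradSq_planeChart (x₀ : EuclideanSpace ℝ (Fin 2)) (ν : ℝ)
    {u : EuclideanSpace ℝ (Fin 2) → ℂ} (hu : Differentiable ℝ u) (z : ℂ) :
    magGradSq (AB x₀ ν) u (planeChart x₀ z) =
      ‖fderiv ℝ (fun z => u (planeChart x₀ z)) z 1 -
        Complex.I * u (planeChart x₀ z) * ((-ν * z.im / ‖z‖ ^ 2 : ℝ) : ℂ)‖ ^ 2 +
      ‖fderiv ℝ (fun z => u (planeChart x₀ z)) z Complex.I -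
        Complex.I * u (planeChart x₀ z) * ((ν * z.re / ‖z‖ ^ 2 : ℝ) : ℂ)‖ ^ 2 := by
  rw [(hasFDerivAt_comp_planeChart x₀ hu z).fderiv, magGradSq, Fin.sum_univ_two]
  have e0 : Complex.orthonormalBasisOneI.repr 1 = EuclideanSpace.single 0 1 := by
    ext i; fin_cases i <;> simp
  have e1 : Complex.orthonormalBasisOneI.repr Complex.I = EuclideanSpace.single 1 1 := by
    ext i; fin_cases i <;> simp
  have hn : ‖planeChart x₀ z - x₀‖ = ‖z‖ := by
    rw [planeChart_apply, add_sub_cancel_left, LinearIsometryEquiv.norm_map]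
  have h0 : (planeChart x₀ z) 0 - x₀ 0 = z.re := by simp [planeChart_apply]
  have h1 : (planeChart x₀ z) 1 - x₀ 1 = z.im := by simp [planeChart_apply]
  simp [AB, hn, h0, h1, e0, e1]

theorem magGradSq_planeChart_circleMap (x₀ : EuclideanSpace ℝ (Fin 2)) (ν : ℝ)
    {u : EuclideanSpace ℝ (Fin 2) → ℂ} (hu : Differentiable ℝ u) {r : ℝ} (hr : 0 < r) (θ : ℝ) :
    r * magGradSq (AB x₀ ν) u (planeChart x₀ (circleMap 0 r θ)) =
      r * ‖fderiv ℝ (fun z => u (planeChart x₀ z)) (circleMap 0 r θ)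
        (Complex.exp (θ * Complex.I))‖ ^ 2 +
      r⁻¹ * ‖fderiv ℝ (fun z => u (planeChart x₀ z)) (circleMap 0 r θ)
          (circleMap 0 r θ * Complex.I) -
        Complex.I * ν * u (planeChart x₀ (circleMap 0 r θ))‖ ^ 2 := by
  rw [magGradSq_planeChart x₀ ν hu]
  set D := fderiv ℝ (fun z => u (planeChart x₀ z)) (circleMap 0 r θ)
  set w := u (planeChart x₀ (circleMap 0 r θ))
  have hr' : (r : ℂ) ≠ 0 := by exact_mod_cast hr.ne'
  have hcm : circleMap 0 r θ = r • (cos θ • (1 : ℂ) + sin θ • Complex.I) := by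
    rw [circleMap, zero_add, Complex.exp_mul_I]
    simp [mul_add]
  have hn : ‖circleMap 0 r θ‖ = r := by rw [norm_circleMap_zero, abs_of_pos hr]
  have hre : (circleMap 0 r θ).re = r * cos θ := by
    rw [circleMap, zero_add, Complex.re_ofReal_mul, Complex.exp_ofReal_mul_I_re]
  have him : (circleMap 0 r θ).im = r * sin θ := by
    rw [circleMap, zero_add, Complex.im_ofReal_mul, Complex.exp_ofReal_mul_I_im]
  have hD1 : D (Complex.exp (θ * Complex.I)) = cos θ * D 1 + sin θ * D Complex.I := by
    have : Complex.exp (θ * Complex.I) = cos θ • (1 : ℂ) + sin θ • Complex.I := by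
      rw [Complex.exp_mul_I]; simp
    rw [this, map_add, map_smul, map_smul]
    simp
  have hD2 : D (circleMap 0 r θ * Complex.I) = r * (-sin θ * D 1 + cos θ * D Complex.I) := by
    have : circleMap 0 r θ * Complex.I = r • ((-sin θ) • (1 : ℂ) + cos θ • Complex.I) := by
      rw [hcm]
      simp only [Complex.real_smul, mul_one, Complex.ofReal_neg]
      linear_combination (r * sin θ : ℂ) * Complex.I_mul_I
    rw [this, map_smul, map_add, map_smul, map_smul]
    simp only [Complex.real_smul, Complex.ofReal_neg]
  rw [hre, him, hn, ← norm_rotation_sq_add _ _ θ, mul_add, hD1, hD2]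
  have hcs : Complex.cos θ ^ 2 + Complex.sin θ ^ 2 = 1 := Complex.cos_sq_add_sin_sq θ
  congr 1
  · congr 3
    push_cast
    field_simp
    ring
  · have hE : (r : ℂ) * (-sin θ * D 1 + cos θ * D Complex.I) - Complex.I * ν * w =
        r * (-sin θ * (D 1 - Complex.I * w * ((-ν * (r * sin θ) / r ^ 2 : ℝ) : ℂ)) +
          cos θ * (D Complex.I - Complex.I * w * ((ν * (r * cos θ) / r ^ 2 : ℝ) : ℂ))) := by
      push_cast
      field_simp
      linear_combination (Complex.I * w * ν) * hcs
    rw [hE, norm_mul, mul_pow, Complex.norm_real, norm_eq_abs, sq_abs]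
    field_simp

theorem continuous_magGradSq_planeChart (x₀ : EuclideanSpace ℝ (Fin 2)) (ν : ℝ)
    {u : EuclideanSpace ℝ (Fin 2) → ℂ} (hu : ContDiff ℝ (⊤ : ℕ∞) u) (hv : VanishesNear x₀ u) :
    Continuous fun z => magGradSq (AB x₀ ν) u (planeChart x₀ z) := by
  have hd : Differentiable ℝ u := hu.differentiable (by simp)
  have hvs : ContDiff ℝ (⊤ : ℕ∞) fun z => u (planeChart x₀ z) := hu.comp (contDiff_planeChart x₀)
  have hDc : Continuous (fderiv ℝ fun z => u (planeChart x₀ z)) :=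
    hvs.continuous_fderiv (by simp)
  rw [continuous_iff_continuousAt]
  intro z
  by_cases hz : z = 0
  · obtain ⟨ε, hε, h0⟩ := hv
    have hball : Metric.ball (0 : ℂ) ε ∈ 𝓝 z := by
      rw [hz]; exact Metric.ball_mem_nhds _ hε
    have hz0 : ∀ᶠ y in 𝓝 z, u (planeChart x₀ y) = 0 := by
      filter_upwards [hball] with y hy
      refine h0 _ ?_
      rwa [← (planeChart x₀).symm_apply_eq.2 (planeChart_zero x₀).symm,
        ← (planeChart x₀).preimage_ball] at hy
    have hEq : (fun z => magGradSq (AB x₀ ν) u (planeChart x₀ z)) =ᶠ[𝓝 z] fun _ => 0 := by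
      filter_upwards [hz0.eventually_nhds] with y hy
      rw [magGradSq_planeChart x₀ ν hd]
      have : (fun z => u (planeChart x₀ z)) =ᶠ[𝓝 y] fun _ => 0 := hy
      rw [this.fderiv_eq, hy.self_of_nhds]
      simp
    exact continuousAt_const.congr hEq.symm
  · simp only [magGradSq_planeChart x₀ ν hd]
    have hzn : ‖z‖ ^ 2 ≠ 0 := by positivity
    have hA : ContinuousAt (fun z : ℂ => -ν * z.im / ‖z‖ ^ 2) z := by
      fun_prop (disch := assumption)
    have hB : ContinuousAt (fun z : ℂ => ν * z.re / ‖z‖ ^ 2) z := by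
      fun_prop (disch := assumption)
    have hA' := Complex.continuous_ofReal.continuousAt.comp hA
    have hB' := Complex.continuous_ofReal.continuousAt.comp hB
    have hvc : ContinuousAt (fun z => u (planeChart x₀ z)) z := hvs.continuous.continuousAt
    have h1 : ContinuousAt (fun z => fderiv ℝ (fun z => u (planeChart x₀ z)) z 1) z := by fun_prop
    have h2 : ContinuousAt (fun z => fderiv ℝ (fun z => u (planeChart x₀ z)) z Complex.I) z := by
      fun_prop
    exact ((h1.sub ((continuousAt_const.mul hvc).mul hA')).norm.pow 2).add
      ((h2.sub ((continuousAt_const.mul hvc).mul hB')).norm.pow 2)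

theorem continuous_circleMap_uncurry : Continuous fun p : ℝ × ℝ => circleMap 0 p.1 p.2 := by
  unfold circleMap
  fun_prop

theorem hasDerivAt_circleMap_radius (r θ : ℝ) :
    HasDerivAt (fun r : ℝ => circleMap 0 r θ) (Complex.exp (θ * Complex.I)) r := by
  simpa [circleMap] using (Complex.ofRealCLM.hasDerivAt (x := r)).mul_const
    (Complex.exp (θ * Complex.I))

/-- The magnetic energy of `u` on the disk, in polar coordinates. -/
theorem setIntegral_magGradSq_eq (x₀ : EuclideanSpace ℝ (Fin 2)) (ν : ℝ) {R : ℝ} (hR : 0 ≤ R)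
    {u : EuclideanSpace ℝ (Fin 2) → ℂ} (hu : ContDiff ℝ (⊤ : ℕ∞) u) (hv : VanishesNear x₀ u) :
    ∫ x in Metric.ball x₀ R, magGradSq (AB x₀ ν) u x =
      ∫ r in 0..R, ∫ θ in (-π)..π,
        r * magGradSq (AB x₀ ν) u (planeChart x₀ (circleMap 0 r θ)) := by
  rw [setIntegral_ball_planeChart,
    setIntegral_ball_eq_polar (continuous_magGradSq_planeChart x₀ ν hu hv) hR]

theorem setIntegral_frontier_eq (x₀ : EuclideanSpace ℝ (Fin 2)) {R : ℝ} (hR : 0 < R)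
    {u : EuclideanSpace ℝ (Fin 2) → ℂ} (hu : Continuous u) :
    ∫ x in frontier (Metric.ball x₀ R), ‖u x‖ ^ 2 ∂μH[1] =
      R * ∫ θ in (-π)..π, ‖u (planeChart x₀ (circleMap 0 R θ))‖ ^ 2 := by
  have hQ := (planeChart x₀).continuous
  rw [frontier_ball x₀ hR.ne', setIntegral_sphere_planeChart,
    setIntegral_sphere_eq R hR (f := fun z => ‖u (planeChart x₀ z)‖ ^ 2) (by fun_prop)]

theorem distInt_mul_integral_le_energy (x₀ : EuclideanSpace ℝ (Fin 2)) (ν : ℝ) {R : ℝ}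
    (hR : 0 < R) {u : EuclideanSpace ℝ (Fin 2) → ℂ} (hu : ContDiff ℝ (⊤ : ℕ∞) u)
    (hv : VanishesNear x₀ u) :
    distInt ν * ∫ θ in (-π)..π, ‖u (planeChart x₀ (circleMap 0 R θ))‖ ^ 2 ≤
      ∫ x in Metric.ball x₀ R, magGradSq (AB x₀ ν) u x := by
  rw [setIntegral_magGradSq_eq x₀ ν hR.le hu hv]
  have hud : Differentiable ℝ u := hu.differentiable (by simp)
  have hFc := continuous_magGradSq_planeChart x₀ ν hu hv
  have hu0 : u (planeChart x₀ 0) = 0 := by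
    obtain ⟨ε, hε, h⟩ := hv
    rw [planeChart_zero]
    exact h _ (Metric.mem_ball_self hε)
  have hvs : ContDiff ℝ (⊤ : ℕ∞) fun z => u (planeChart x₀ z) := hu.comp (contDiff_planeChart x₀)
  set d := distInt ν
  have hd0 : 0 ≤ d := distInt_nonneg ν
  set f : ℂ → ℝ := fun z => magGradSq (AB x₀ ν) u (planeChart x₀ z)
  set v : ℂ → ℂ := fun z => u (planeChart x₀ z)
  have hpol : ∀ {r : ℝ}, 0 < r → ∀ θ : ℝ, r * f (circleMap 0 r θ) =
      r * ‖fderiv ℝ v (circleMap 0 r θ) (Complex.exp (θ * Complex.I))‖ ^ 2 +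
      r⁻¹ * ‖fderiv ℝ v (circleMap 0 r θ) (circleMap 0 r θ * Complex.I) -
        Complex.I * ν * v (circleMap 0 r θ)‖ ^ 2 :=
    fun hr θ => magGradSq_planeChart_circleMap x₀ ν hud hr θ
  have hv0 : v 0 = 0 := hu0
  change d * ∫ θ in (-π)..π, ‖v (circleMap 0 R θ)‖ ^ 2 ≤
    ∫ r in 0..R, ∫ θ in (-π)..π, r * f (circleMap 0 r θ)
  have hvc : Continuous v := hvs.continuous
  have hDc : Continuous (fderiv ℝ v) := hvs.continuous_fderiv (by simp)
  have hvd : Differentiable ℝ v := hvs.differentiable (by simp)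
  have hcm := continuous_circleMap_uncurry
  have hpi : -π ≤ π := by linarith [pi_pos]
  let H : ℝ → ℝ → ℝ := fun r θ => d * (2 * inner ℝ (v (circleMap 0 r θ))
    (fderiv ℝ v (circleMap 0 r θ) (Complex.exp (θ * Complex.I))))
  have hHc : Continuous (Function.uncurry H) := by
    have h1 : Continuous fun p : ℝ × ℝ => v (circleMap 0 p.1 p.2) := hvc.comp hcm
    have h2 : Continuous fun p : ℝ × ℝ =>
        fderiv ℝ v (circleMap 0 p.1 p.2) (Complex.exp (p.2 * Complex.I)) :=
      (hDc.comp hcm).clm_apply (by fun_prop)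
    exact continuous_const.mul (continuous_const.mul (h1.inner h2))
  have hrad : ∀ θ, ∫ r in 0..R, H r θ = d * ‖v (circleMap 0 R θ)‖ ^ 2 := by
    intro θ
    have hder : ∀ r ∈ uIcc 0 R, HasDerivAt (fun r => d * ‖v (circleMap 0 r θ)‖ ^ 2) (H r θ) r := by
      intro r _
      exact (((hvd _).hasFDerivAt.comp_hasDerivAt r
        (hasDerivAt_circleMap_radius r θ)).norm_sq).const_mul d
    rw [intervalIntegral.integral_eq_sub_of_hasDerivAt hder
      ((hHc.comp (by fun_prop : Continuous fun r : ℝ => (r, θ))).intervalIntegrable _ _)]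
    simp [hv0]
  have hswap : ∫ r in 0..R, ∫ θ in (-π)..π, H r θ =
      d * ∫ θ in (-π)..π, ‖v (circleMap 0 R θ)‖ ^ 2 := by
    rw [intervalIntegral_intervalIntegral_swap, ← intervalIntegral.integral_const_mul]
    · simp only [hrad]
    · exact (hHc.continuousOn.integrableOn_compact
        (isCompact_uIcc.prod isCompact_uIcc)).mono_set
        (prod_mono uIoc_subset_uIcc uIoc_subset_uIcc)
  have hFc2 : Continuous (Function.uncurry fun r θ : ℝ => r * f (circleMap 0 r θ)) :=
    continuous_fst.mul (hFc.comp hcm)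
  rw [← hswap]
  refine intervalIntegral.integral_mono_on_of_le_Ioo hR.le
    ((intervalIntegral.continuous_parametric_intervalIntegral_of_continuous' hHc _ _
      ).intervalIntegrable _ _)
    ((intervalIntegral.continuous_parametric_intervalIntegral_of_continuous' hFc2 _ _
      ).intervalIntegrable _ _) fun r hr => ?_
  have hr0 : 0 < r := hr.1
  have hcr : Continuous (circleMap 0 r) := continuous_circleMap 0 r
  have ha : Continuous fun θ : ℝ =>
      fderiv ℝ v (circleMap 0 r θ) (Complex.exp (θ * Complex.I)) :=
    (hDc.comp hcr).clm_apply (by fun_prop)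
  have hb : Continuous fun θ : ℝ =>
      fderiv ℝ v (circleMap 0 r θ) (circleMap 0 r θ * Complex.I) :=
    (hDc.comp hcr).clm_apply (by fun_prop)
  have hw : Continuous fun θ : ℝ => v (circleMap 0 r θ) := hvc.comp hcr
  have hwirt := distInt_sq_mul_integral_le
    (fun θ => (hvd (circleMap 0 r θ)).hasFDerivAt.comp_hasDerivAt θ (hasDerivAt_circleMap 0 r θ))
    hb (by
      have : circleMap 0 r (-π) = circleMap 0 r π := by
        have := periodic_circleMap 0 r (-π)
        rw [← this]; congr 1; ring
      simp only [Function.comp, this]) ν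
  simp only [Function.comp_apply] at hwirt
  simp only [hpol hr0]
  rw [intervalIntegral.integral_add (Continuous.intervalIntegrable (by fun_prop) _ _)
    (Continuous.intervalIntegrable (by fun_prop) _ _),
    intervalIntegral.integral_const_mul r⁻¹]
  refine le_trans ?_ (add_le_add_right (mul_le_mul_of_nonneg_left hwirt (inv_nonneg.2 hr0.le)) _)
  rw [← intervalIntegral.integral_const_mul, ← intervalIntegral.integral_const_mul,
    ← intervalIntegral.integral_add (Continuous.intervalIntegrable (by fun_prop) _ _)
    (Continuous.intervalIntegrable (by fun_prop) _ _)]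
  refine intervalIntegral.integral_mono_on hpi
    ((hHc.comp (by fun_prop : Continuous fun θ : ℝ => (r, θ))).intervalIntegrable _ _)
    (Continuous.intervalIntegrable (by fun_prop) _ _) fun θ _ => ?_
  set a := fderiv ℝ v (circleMap 0 r θ) (Complex.exp (θ * Complex.I)) with ha'
  set w := v (circleMap 0 r θ) with hw'
  have hcs := real_inner_le_norm w a
  have hmain : d * (2 * inner ℝ w a) ≤ d * (2 * (‖w‖ * ‖a‖)) := by gcongr
  refine hmain.trans ?_
  have hsq : 0 ≤ r⁻¹ * (r * ‖a‖ - d * ‖w‖) ^ 2 := by positivity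
  have : r⁻¹ * (r * ‖a‖ - d * ‖w‖) ^ 2 =
      r * ‖a‖ ^ 2 + r⁻¹ * (d ^ 2 * ‖w‖ ^ 2) - d * (2 * (‖w‖ * ‖a‖)) := by
    field_simp
    ring
  linarith

/-- The radial power `(r / R) ^ d`, cut off below the radius `R * exp (-T)`. -/
noncomputable def cutoffPower (d R T r : ℝ) : ℝ :=
  exp (d * log (r / R)) * smoothTransition (1 + log (r / R) / T)

/-- The derivative of `cutoffPower d R T` on the positive reals. -/
noncomputable def cutoffPowerDeriv (d R T r : ℝ) : ℝ :=
  d / r * cutoffPower d R T r +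
    exp (d * log (r / R)) * (deriv smoothTransition (1 + log (r / R) / T) / (T * r))

theorem hasDerivAt_cutoffPower (d T : ℝ) {R r : ℝ} (hR : 0 < R) (hr : 0 < r) :
    HasDerivAt (cutoffPower d R T) (cutoffPowerDeriv d R T r) r := by
  have hlog : HasDerivAt (fun r => log (r / R)) (1 / r) r := by
    have := ((hasDerivAt_id r).div_const R).log (div_pos hr hR).ne'
    convert! this using 1
    simp
    field_simp
  have hφ : HasDerivAt smoothTransition (deriv smoothTransition (1 + log (r / R) / T))
      (1 + log (r / R) / T) :=
    ((smoothTransition.contDiff (n := 1)).differentiable (by simp) _).hasDerivAt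
  have h := ((hlog.const_mul d).exp).mul (hφ.comp r ((hlog.div_const T).const_add 1))
  convert! h using 1
  simp only [cutoffPowerDeriv, cutoffPower, Function.comp_apply]
  field_simp

theorem contDiffAt_cutoffPower (d T : ℝ) {R r : ℝ} (hR : 0 < R) (hr : 0 < r) :
    ContDiffAt ℝ (⊤ : ℕ∞) (cutoffPower d R T) r := by
  have hlog : ContDiffAt ℝ (⊤ : ℕ∞) (fun r => log (r / R)) r :=
    (contDiffAt_id.div_const R).log (div_pos hr hR).ne'
  exact ((contDiffAt_const.mul hlog).exp).mul
    (smoothTransition.contDiffAt.comp r (contDiffAt_const.add (hlog.div_const T)))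

theorem cutoffPower_eq_zero (d : ℝ) {R T r : ℝ} (hR : 0 < R) (hT : 0 < T) (hr : 0 < r)
    (h : r ≤ R * exp (-T)) : cutoffPower d R T r = 0 := by
  have h1 : log (r / R) ≤ -T := by
    rw [log_le_iff_le_exp (by positivity), div_le_iff₀ hR]
    linarith
  rw [cutoffPower, smoothTransition.zero_of_nonpos, mul_zero]
  have : log (r / R) / T ≤ -1 := by
    rw [div_le_iff₀ hT]
    linarith
  linarith

theorem cutoffPower_self (d T : ℝ) {R : ℝ} (hR : 0 < R) : cutoffPower d R T R = 1 := by
  simp [cutoffPower, div_self hR.ne']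

theorem continuousOn_cutoffPowerDeriv (d T : ℝ) {R : ℝ} (hR : 0 < R) (hT : 0 < T) :
    ContinuousOn (cutoffPowerDeriv d R T) (Ioi 0) := by
  intro r hr
  have hr : 0 < r := hr
  have hlog : ContinuousAt (fun r => log (r / R)) r :=
    (continuousAt_id.div_const R).log (div_pos hr hR).ne'
  have hφ : Continuous (deriv smoothTransition) :=
    (smoothTransition.contDiff (n := 1)).continuous_deriv le_rfl
  have hG : ContinuousAt (cutoffPower d R T) r := (hasDerivAt_cutoffPower d T hR hr).continuousAt
  have h1 : ContinuousAt (fun r : ℝ => d / r) r := continuousAt_const.div continuousAt_id hr.ne'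
  have h2 : ContinuousAt (fun r => deriv smoothTransition (1 + log (r / R) / T)) r :=
    hφ.continuousAt.comp (continuousAt_const.add (hlog.div_const T))
  have h3 : ContinuousAt (fun r : ℝ => T * r) r := by fun_prop
  exact ((h1.mul hG).add (((continuousAt_const.mul hlog).rexp).mul
    (h2.div h3 (by positivity)))).continuousWithinAt

theorem exists_forall_radialEnergy_le : ∃ C : ℝ, ∀ d R T : ℝ, 0 ≤ d → 0 < R → 0 < T →
    ∫ r in (R * exp (-T))..R, (r * cutoffPowerDeriv d R T r ^ 2 +
      r⁻¹ * (d ^ 2 * cutoffPower d R T r ^ 2)) ≤ d + C / T := by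
  have hφ : Continuous (deriv smoothTransition) :=
    (smoothTransition.contDiff (n := 1)).continuous_deriv le_rfl
  obtain ⟨C, hC⟩ := isCompact_Icc.exists_bound_of_continuousOn (hφ.continuousOn (s := Icc 0 1))
  refine ⟨C ^ 2, fun d R T hd hR hT => ?_⟩
  set a := R * exp (-T) with ha
  have ha0 : 0 < a := by positivity
  have haR : a ≤ R := mul_le_of_le_one_right hR.le (exp_le_one_iff.2 (by linarith))
  have hsub : uIcc a R ⊆ Ioi 0 := by
    rw [uIcc_of_le haR]; exact fun r hr => ha0.trans_le hr.1
  have hGc : ContinuousOn (cutoffPower d R T) (uIcc a R) := fun r hr =>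
    (hasDerivAt_cutoffPower d T hR (hsub hr)).continuousAt.continuousWithinAt
  have hGc' : ContinuousOn (cutoffPowerDeriv d R T) (uIcc a R) :=
    (continuousOn_cutoffPowerDeriv d T hR hT).mono hsub
  have hinv : ContinuousOn (fun r : ℝ => r⁻¹) (uIcc a R) :=
    continuousOn_inv₀.mono fun r hr => (ne_of_gt (hsub hr) : r ≠ 0)
  have hder : ∀ r ∈ uIcc a R, HasDerivAt
      (fun r => d * cutoffPower d R T r ^ 2 + C ^ 2 / T ^ 2 * log r)
      (d * (2 * cutoffPower d R T r * cutoffPowerDeriv d R T r) + C ^ 2 / T ^ 2 * r⁻¹) r := by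
    intro r hr
    have h := (((hasDerivAt_cutoffPower d T hR (hsub hr)).pow 2).const_mul d).add
      ((hasDerivAt_log (ne_of_gt (hsub hr))).const_mul (C ^ 2 / T ^ 2))
    convert! h using 1
    simp
  have hint := intervalIntegral.integral_eq_sub_of_hasDerivAt hder
    (ContinuousOn.intervalIntegrable (by fun_prop))
  have hloga : log a = log R - T := by
    rw [ha, log_mul hR.ne' (exp_ne_zero _), log_exp]; ring
  rw [cutoffPower_self d T hR, cutoffPower_eq_zero d hR hT ha0 le_rfl, hloga] at hint
  have hval : d * (1 : ℝ) ^ 2 + C ^ 2 / T ^ 2 * log R -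
      (d * 0 ^ 2 + C ^ 2 / T ^ 2 * (log R - T)) = d + C ^ 2 / T := by
    field_simp
    ring
  rw [← hval, ← hint]
  refine intervalIntegral.integral_mono_on haR (ContinuousOn.intervalIntegrable (by fun_prop))
    (ContinuousOn.intervalIntegrable (by fun_prop)) fun r hr => ?_
  have hr0 : 0 < r := ha0.trans_le hr.1
  have ht0 : log (r / R) ≤ 0 := log_nonpos (by positivity) ((div_le_one hR).2 hr.2)
  have htT : -T ≤ log (r / R) := by
    rw [le_log_iff_exp_le (by positivity), le_div_iff₀ hR]
    linarith [hr.1]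
  have hmem : 1 + log (r / R) / T ∈ Icc (0 : ℝ) 1 := by
    constructor
    · have : -1 ≤ log (r / R) / T := by rw [le_div_iff₀ hT]; linarith
      linarith
    · have : log (r / R) / T ≤ 0 := div_nonpos_of_nonpos_of_nonneg ht0 hT.le
      linarith
  have hφC := hC _ hmem
  have hE : exp (d * log (r / R)) ≤ 1 :=
    exp_le_one_iff.2 (mul_nonpos_of_nonneg_of_nonpos hd ht0)
  have hE0 := exp_pos (d * log (r / R))
  unfold cutoffPowerDeriv
  set G := cutoffPower d R T r
  set E := exp (d * log (r / R))
  set p := deriv smoothTransition (1 + log (r / R) / T)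
  have hp : (E * p) ^ 2 ≤ C ^ 2 := by
    have h2 : |E * p| ≤ C := by
      rw [abs_mul, abs_of_pos hE0]
      exact (mul_le_of_le_one_left (abs_nonneg p) hE).trans hφC
    exact sq_le_sq' (abs_le.1 h2).1 (abs_le.1 h2).2
  have hid : r * (d / r * G + E * (p / (T * r))) ^ 2 + r⁻¹ * (d ^ 2 * G ^ 2) =
      d * (2 * G * (d / r * G + E * (p / (T * r)))) + (E * p) ^ 2 / T ^ 2 * r⁻¹ := by
    field_simp
    ring
  rw [hid]
  gcongr

/-- The test function `(r / R) ^ d * exp (i k θ)`, cut off near the origin. -/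
noncomputable def cutoffHarmonic (d R T : ℝ) (k : ℤ) (z : ℂ) : ℂ :=
  if z = 0 then 0 else (cutoffPower d R T ‖z‖ : ℂ) * (z / ‖z‖) ^ k

theorem cutoffHarmonic_circleMap (d R T : ℝ) (k : ℤ) {r : ℝ} (hr : 0 < r) (θ : ℝ) :
    cutoffHarmonic d R T k (circleMap 0 r θ) =
      cutoffPower d R T r * Complex.exp (k * (θ * Complex.I)) := by
  have hr' : (r : ℂ) ≠ 0 := by exact_mod_cast hr.ne'
  have hn : ‖circleMap 0 r θ‖ = r := by rw [norm_circleMap_zero, abs_of_pos hr]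
  rw [cutoffHarmonic, if_neg (circleMap_ne_center hr.ne'), hn, Complex.exp_int_mul, circleMap,
    zero_add, mul_div_cancel_left₀ _ hr']

theorem cutoffHarmonic_eq_zero (d : ℝ) {R T : ℝ} (hR : 0 < R) (hT : 0 < T) (k : ℤ) {z : ℂ}
    (hz : ‖z‖ ≤ R * exp (-T)) : cutoffHarmonic d R T k z = 0 := by
  by_cases h : z = 0
  · rw [cutoffHarmonic, if_pos h]
  · rw [cutoffHarmonic, if_neg h, cutoffPower_eq_zero d hR hT (norm_pos_iff.2 h) hz,
      Complex.ofReal_zero, zero_mul]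

theorem contDiff_cutoffHarmonic (d : ℝ) {R T : ℝ} (hR : 0 < R) (hT : 0 < T) (k : ℤ) :
    ContDiff ℝ (⊤ : ℕ∞) (cutoffHarmonic d R T k) := by
  rw [contDiff_iff_contDiffAt]
  intro z
  by_cases hz : z = 0
  · have : cutoffHarmonic d R T k =ᶠ[𝓝 z] fun _ => 0 := by
      have hball : Metric.ball (0 : ℂ) (R * exp (-T)) ∈ 𝓝 z := by
        rw [hz]; exact Metric.ball_mem_nhds _ (by positivity)
      filter_upwards [hball] with y hy
      exact cutoffHarmonic_eq_zero d hR hT k (mem_ball_zero_iff.1 hy).le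
    exact contDiffAt_const.congr_of_eventuallyEq this
  · have hev : cutoffHarmonic d R T k =ᶠ[𝓝 z]
        fun z => (cutoffPower d R T ‖z‖ : ℂ) * (z / ‖z‖) ^ k := by
      filter_upwards [isOpen_ne.mem_nhds hz] with y hy
      exact if_neg hy
    refine ContDiffAt.congr_of_eventuallyEq ?_ hev
    have hn : ContDiffAt ℝ (⊤ : ℕ∞) (fun z : ℂ => ‖z‖) z := contDiffAt_norm ℝ hz
    have hnC : ContDiffAt ℝ (⊤ : ℕ∞) (fun z : ℂ => (‖z‖ : ℂ)) z :=
      Complex.ofRealCLM.contDiff.contDiffAt.comp z hn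
    have hn0 : (‖z‖ : ℂ) ≠ 0 := by simpa using hz
    have hG : ContDiffAt ℝ (⊤ : ℕ∞) (fun z : ℂ => (cutoffPower d R T ‖z‖ : ℂ)) z :=
      Complex.ofRealCLM.contDiff.contDiffAt.comp z
        ((contDiffAt_cutoffPower d T hR (norm_pos_iff.2 hz)).comp z hn)
    have hq : ContDiffAt ℝ (⊤ : ℕ∞) (fun z : ℂ => z / (‖z‖ : ℂ)) z := by
      simp only [div_eq_mul_inv]
      exact contDiffAt_id.mul (hnC.inv hn0)
    have hpow : ContDiffAt ℝ (⊤ : ℕ∞) (fun w : ℂ => w ^ k) (z / (‖z‖ : ℂ)) := by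
      have h : AnalyticAt ℂ (fun w : ℂ => w ^ k) (z / (‖z‖ : ℂ)) :=
        analyticAt_id.zpow (div_ne_zero hz hn0)
      exact h.contDiffAt.restrict_scalars ℝ
    exact hG.mul (ContDiffAt.comp (g := fun w : ℂ => w ^ k) z hpow hq)

/-- The function on the plane that reads as `cutoffHarmonic` in the chart centered at `x₀`. -/
noncomputable def steklovTrial (x₀ : EuclideanSpace ℝ (Fin 2)) (d R T : ℝ) (k : ℤ)
    (x : EuclideanSpace ℝ (Fin 2)) : ℂ :=
  cutoffHarmonic d R T k ((planeChart x₀).symm x)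

theorem steklovTrial_planeChart (x₀ : EuclideanSpace ℝ (Fin 2)) (d R T : ℝ) (k : ℤ) (z : ℂ) :
    steklovTrial x₀ d R T k (planeChart x₀ z) = cutoffHarmonic d R T k z := by
  rw [steklovTrial, IsometryEquiv.symm_apply_apply]

theorem contDiff_steklovTrial (x₀ : EuclideanSpace ℝ (Fin 2)) (d : ℝ) {R T : ℝ} (hR : 0 < R)
    (hT : 0 < T) (k : ℤ) : ContDiff ℝ (⊤ : ℕ∞) (steklovTrial x₀ d R T k) := by
  have hsymm : ⇑(planeChart x₀).symm = fun x =>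
      Complex.orthonormalBasisOneI.repr.symm (-x₀ + x) := rfl
  refine (contDiff_cutoffHarmonic d hR hT k).comp ?_
  rw [hsymm]
  exact Complex.orthonormalBasisOneI.repr.symm.toContinuousLinearEquiv.contDiff.comp
    (contDiff_const.add contDiff_id)

theorem vanishesNear_steklovTrial (x₀ : EuclideanSpace ℝ (Fin 2)) (d : ℝ) {R T : ℝ} (hR : 0 < R)
    (hT : 0 < T) (k : ℤ) : VanishesNear x₀ (steklovTrial x₀ d R T k) := by
  refine ⟨R * exp (-T), by positivity, fun x hx => ?_⟩
  refine cutoffHarmonic_eq_zero d hR hT k ?_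
  rw [← planeChart_zero x₀, ← (planeChart x₀).apply_symm_apply x, Metric.mem_ball,
    (planeChart x₀).isometry.dist_eq, dist_zero_right] at hx
  exact hx.le

theorem setIntegral_frontier_steklovTrial (x₀ : EuclideanSpace ℝ (Fin 2)) (d : ℝ) {R T : ℝ}
    (hR : 0 < R) (hT : 0 < T) (k : ℤ) :
    ∫ x in frontier (Metric.ball x₀ R), ‖steklovTrial x₀ d R T k x‖ ^ 2 ∂μH[1] = R * (2 * π) := by
  rw [setIntegral_frontier_eq x₀ hR (contDiff_steklovTrial x₀ d hR hT k).continuous]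
  have h : ∀ θ : ℝ, ‖steklovTrial x₀ d R T k (planeChart x₀ (circleMap 0 R θ))‖ ^ 2 = 1 := by
    intro θ
    rw [steklovTrial_planeChart, cutoffHarmonic_circleMap d R T k hR, cutoffPower_self d T hR,
      ← mul_assoc, ← Complex.ofReal_intCast, ← Complex.ofReal_mul, norm_mul,
      Complex.norm_exp_ofReal_mul_I]
    simp
  simp only [h, intervalIntegral.integral_const, smul_eq_mul, mul_one]
  ring

theorem magGradSq_steklovTrial (x₀ : EuclideanSpace ℝ (Fin 2)) (ν d : ℝ) {R T r : ℝ}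
    (hR : 0 < R) (hT : 0 < T) (hr : 0 < r) (k : ℤ) (θ : ℝ) :
    r * magGradSq (AB x₀ ν) (steklovTrial x₀ d R T k) (planeChart x₀ (circleMap 0 r θ)) =
      r * cutoffPowerDeriv d R T r ^ 2 + r⁻¹ * ((ν - k) ^ 2 * cutoffPower d R T r ^ 2) := by
  rw [magGradSq_planeChart_circleMap x₀ ν
    ((contDiff_steklovTrial x₀ d hR hT k).differentiable (by simp)) hr]
  simp only [steklovTrial_planeChart]
  have hd : DifferentiableAt ℝ (cutoffHarmonic d R T k) (circleMap 0 r θ) :=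
    (contDiff_cutoffHarmonic d hR hT k).differentiable (by simp) _
  have hnorm : ‖Complex.exp (k * (θ * Complex.I))‖ = 1 := by
    rw [← mul_assoc, ← Complex.ofReal_intCast, ← Complex.ofReal_mul, Complex.norm_exp_ofReal_mul_I]
  have h1 : fderiv ℝ (cutoffHarmonic d R T k) (circleMap 0 r θ) (Complex.exp (θ * Complex.I)) =
      cutoffPowerDeriv d R T r * Complex.exp (k * (θ * Complex.I)) := by
    refine (hd.hasFDerivAt.comp_hasDerivAt r (hasDerivAt_circleMap_radius r θ)).unique ?_
    refine HasDerivAt.congr_of_eventuallyEq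
      (((hasDerivAt_cutoffPower d T hR hr).ofReal_comp).mul_const _) ?_
    filter_upwards [lt_mem_nhds hr] with s hs
    exact cutoffHarmonic_circleMap d R T k hs θ
  have h2 : fderiv ℝ (cutoffHarmonic d R T k) (circleMap 0 r θ) (circleMap 0 r θ * Complex.I) =
      cutoffPower d R T r * (Complex.exp (k * (θ * Complex.I)) * (k * Complex.I)) := by
    refine (hd.hasFDerivAt.comp_hasDerivAt θ (hasDerivAt_circleMap 0 r θ)).unique ?_
    have he : HasDerivAt (fun θ : ℝ => (k * (θ * Complex.I) : ℂ)) (k * Complex.I) θ := by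
      simpa using ((Complex.ofRealCLM.hasDerivAt (x := θ)).mul_const Complex.I).const_mul (k : ℂ)
    refine HasDerivAt.congr_of_eventuallyEq (he.cexp.const_mul _) ?_
    exact Eventually.of_forall fun s => cutoffHarmonic_circleMap d R T k hr s
  have h3 : (cutoffPower d R T r : ℂ) * (Complex.exp (k * (θ * Complex.I)) * (k * Complex.I)) -
      Complex.I * ν * (cutoffPower d R T r * Complex.exp (k * (θ * Complex.I))) =
      (((k - ν) * cutoffPower d R T r : ℝ) : ℂ) *
        (Complex.I * Complex.exp (k * (θ * Complex.I))) := by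
    push_cast
    ring
  rw [h1, h2, cutoffHarmonic_circleMap d R T k hr, h3, norm_mul, norm_mul, norm_mul, hnorm,
    Complex.norm_I, Complex.norm_real, Complex.norm_real, norm_eq_abs, norm_eq_abs]
  simp only [mul_one, sq_abs]
  ring

theorem energy_steklovTrial (x₀ : EuclideanSpace ℝ (Fin 2)) (ν : ℝ) {R T : ℝ} (hR : 0 < R)
    (hT : 0 < T) :
    ∫ x in Metric.ball x₀ R,
        magGradSq (AB x₀ ν) (steklovTrial x₀ (distInt ν) R T (round ν)) x =
      2 * π * ∫ r in (R * exp (-T))..R, (r * cutoffPowerDeriv (distInt ν) R T r ^ 2 +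
        r⁻¹ * (distInt ν ^ 2 * cutoffPower (distInt ν) R T r ^ 2)) := by
  set d := distInt ν
  set a := R * exp (-T) with ha
  have ha0 : 0 < a := by positivity
  have haR : a ≤ R := mul_le_of_le_one_right hR.le (exp_le_one_iff.2 (by linarith))
  have hu := contDiff_steklovTrial x₀ d hR hT (round ν)
  have hv := vanishesNear_steklovTrial x₀ d hR hT (round ν)
  have hFc : Continuous (Function.uncurry fun r θ : ℝ => r * magGradSq (AB x₀ ν)
      (steklovTrial x₀ d R T (round ν)) (planeChart x₀ (circleMap 0 r θ))) :=
    continuous_fst.mul ((continuous_magGradSq_planeChart x₀ ν hu hv).comp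
      continuous_circleMap_uncurry)
  have hJ := intervalIntegral.continuous_parametric_intervalIntegral_of_continuous' hFc
    (μ := volume) (-π) π
  have hval : ∀ r, 0 < r → ∫ θ in (-π)..π, r * magGradSq (AB x₀ ν)
      (steklovTrial x₀ d R T (round ν)) (planeChart x₀ (circleMap 0 r θ)) =
      2 * π * (r * cutoffPowerDeriv d R T r ^ 2 + r⁻¹ * (d ^ 2 * cutoffPower d R T r ^ 2)) := by
    intro r hr
    have hd2 : (ν - round ν) ^ 2 = d ^ 2 := by
      rw [← sq_abs, ← distInt_eq_abs_sub_round]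
    simp only [magGradSq_steklovTrial x₀ ν d hR hT hr, hd2, intervalIntegral.integral_const,
      smul_eq_mul]
    ring
  rw [setIntegral_magGradSq_eq x₀ ν hR.le hu hv, ← intervalIntegral.integral_const_mul,
    ← intervalIntegral.integral_add_adjacent_intervals (hJ.intervalIntegrable 0 a)
      (hJ.intervalIntegrable a R)]
  have hzero : ∫ r in 0..a, ∫ θ in (-π)..π, r * magGradSq (AB x₀ ν)
      (steklovTrial x₀ d R T (round ν)) (planeChart x₀ (circleMap 0 r θ)) = 0 := by
    rw [intervalIntegral.integral_congr_Ioo_of_le (g := fun _ => 0) ha0.le,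
      intervalIntegral.integral_zero]
    intro r hr
    have hG : ∀ᶠ s in 𝓝 r, cutoffPower d R T s = 0 := by
      filter_upwards [isOpen_Ioo.mem_nhds hr] with s hs
      exact cutoffPower_eq_zero d hR hT hs.1 hs.2.le
    have hG' : cutoffPowerDeriv d R T r = 0 :=
      (hasDerivAt_cutoffPower d T hR hr.1).unique
        ((hasDerivAt_const r (0 : ℝ)).congr_of_eventuallyEq hG)
    simp only [hval r hr.1, hG', hG.self_of_nhds]
    simp
  rw [hzero, zero_add]
  refine intervalIntegral.integral_congr fun r hr => ?_
  rw [uIcc_of_le haR] at hr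
  exact hval r (ha0.trans_le hr.1)

/-- The first magnetic Steklov eigenvalue of the disk of radius R centered at the pole
of the Aharonov–Bohm potential with flux ν equals d(ν,ℤ)/R. -/
theorem steklov_disk (x₀ : EuclideanSpace ℝ (Fin 2)) (R : ℝ) (hR : 0 < R) (ν : ℝ) :
    sigma1 x₀ ν (Metric.ball x₀ R) = distInt ν / R := by
  have hlb : distInt ν / R ∈ lowerBounds {q | ∃ u : EuclideanSpace ℝ (Fin 2) → ℂ,
      ContDiff ℝ (⊤ : ℕ∞) u ∧ VanishesNear x₀ u ∧
      0 < ∫ x in frontier (Metric.ball x₀ R), ‖u x‖ ^ 2 ∂(μH[1]) ∧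
      q = (∫ x in Metric.ball x₀ R, magGradSq (AB x₀ ν) u x) /
        ∫ x in frontier (Metric.ball x₀ R), ‖u x‖ ^ 2 ∂(μH[1])} := by
    rintro q ⟨u, hu, hv, hpos, rfl⟩
    have h := distInt_mul_integral_le_energy x₀ ν hR hu hv
    rw [le_div_iff₀ hpos, setIntegral_frontier_eq x₀ hR hu.continuous]
    rwa [← mul_assoc, div_mul_cancel₀ _ hR.ne']
  obtain ⟨C, hC⟩ := exists_forall_radialEnergy_le
  have hq : ∀ T : ℝ, 0 < T → sigma1 x₀ ν (Metric.ball x₀ R) ≤ (distInt ν + C / T) / R := by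
    intro T hT
    have hden := setIntegral_frontier_steklovTrial x₀ (distInt ν) hR hT (round ν)
    refine (csInf_le ⟨_, hlb⟩ ⟨_, contDiff_steklovTrial x₀ (distInt ν) hR hT (round ν),
      vanishesNear_steklovTrial x₀ (distInt ν) hR hT (round ν),
      hden ▸ by positivity, rfl⟩).trans ?_
    rw [hden, energy_steklovTrial x₀ ν hR hT, mul_comm R (2 * π), mul_div_mul_left _ _ two_pi_pos.ne']
    exact div_le_div_of_nonneg_right (hC _ _ _ (distInt_nonneg ν) hR hT) hR.le
  apply le_antisymm
  · have hlim : Tendsto (fun T : ℝ => (distInt ν + C / T) / R) atTop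
        (𝓝 ((distInt ν + 0) / R)) :=
      (tendsto_const_nhds.add (tendsto_const_nhds.div_atTop tendsto_id)).div_const R
    rw [add_zero] at hlim
    exact ge_of_tendsto hlim ((eventually_gt_atTop 0).mono hq)
  · refine le_csInf ?_ hlb
    exact ⟨_, _, contDiff_steklovTrial x₀ (distInt ν) hR one_pos (round ν),
      vanishesNear_steklovTrial x₀ (distInt ν) hR one_pos (round ν),
      setIntegral_frontier_steklovTrial x₀ (distInt ν) hR one_pos (round ν) ▸ by positivity, rfl⟩
end
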